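/- arXiv:1310.3216 — 4 statements merged into one kernel-verified Lean document; each statement's English description precedes it below -/
import Mathlib

section
/- Let G be a finitely generated nilpotent group with finite symmetric generating set B_G and word length |·|_G, let (X,μ,T) be an ergodic probability G-space, and let f : G × X → [0,∞) be an integrable sub-cocycle over this G-space. Then there exists a constant M ≥ 1 such that μ{x ∈ X : f(g,x) ≥ M·|g|_G} → 0 as |g|_G → ∞; that is, for every ε > 0 there is N such that every g ∈ G with |g|_G ≥ N satisfies μ{x ∈ X : f(g,x) ≥ M·|g|_G} < ε. -/
open MeasureTheory Filter

/-- Word length of `g` with respect to a generating set `S`: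
the least `n` such that `g` is a product of `n` elements of `S`. -/
noncomputable def wlen {G : Type*} [Group G] (S : Set G) (g : G) : ℕ :=
  sInf {n : ℕ | ∃ l : List G, (∀ s ∈ l, s ∈ S) ∧ l.length = n ∧ l.prod = g}

open scoped commutatorElement

section WeightedWords

variable {G : Type*} [Group G]

/-- `IteratedCommutator S i g`: the element `g` is, up to inversions, an iterated commutator
(with arbitrary bracketing) of `i` elements of `S`. -/
inductive IteratedCommutator (S : Set G) : ℕ → G → Prop
  | base {s : G} : s ∈ S → IteratedCommutator S 1 s
  | comm {i j : ℕ} {a b : G} : IteratedCommutator S i a → IteratedCommutator S j b →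
      IteratedCommutator S (i + j) ⁅a, b⁆
  | inv {i : ℕ} {a : G} : IteratedCommutator S i a → IteratedCommutator S i a⁻¹

/-- `HasCost x L g r`: the element `g` is a product of letters, a letter from `L i` costing `x ^ i`,
of total cost at most `r`. -/
inductive HasCost (x : ℝ) (L : ℕ → Set G) : G → ℝ → Prop
  | one {r : ℝ} : 0 ≤ r → HasCost x L 1 r
  | cons {i : ℕ} {t g : G} {r r' : ℝ} : t ∈ L i → HasCost x L g r → x ^ i + r ≤ r' →
      HasCost x L (t * g) r'

/-- The letters that are iterated commutators of weight at least `i`, graded by weight. -/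
def commutatorLetters (S : Set G) (i : ℕ) : ℕ → Set G :=
  fun j => {t | i ≤ j ∧ IteratedCommutator S j t}

/-- The elements of `S` as letters of weight one. -/
def generatorLetters (S : Set G) : ℕ → Set G :=
  fun j => {t | j = 1 ∧ t ∈ S}

lemma IteratedCommutator.pos {S : Set G} {i : ℕ} {g : G} (h : IteratedCommutator S i g) :
    1 ≤ i := by
  induction h <;> omega

namespace HasCost

variable {x : ℝ} {L L' : ℕ → Set G} {S : Set G} {g h : G} {r r' : ℝ}

lemma weaken (hg : HasCost x L g r) (hr : r ≤ r') : HasCost x L g r' := by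
  cases hg with
  | one h0 => exact .one (h0.trans hr)
  | cons ht hg h => exact .cons ht hg (h.trans hr)

lemma mono (hL : ∀ i, L i ⊆ L' i) (hg : HasCost x L g r) : HasCost x L' g r := by
  induction hg with
  | one h0 => exact .one h0
  | cons ht _ h ih => exact .cons (hL _ ht) ih h

lemma nonneg (hx : 0 ≤ x) (hg : HasCost x L g r) : 0 ≤ r := by
  induction hg with
  | one h0 => exact h0
  | cons ht _ h ih => exact (add_nonneg (pow_nonneg hx _) ih).trans h

lemma letter {i : ℕ} {t : G} (ht : t ∈ L i) : HasCost x L t (x ^ i) := by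
  simpa using HasCost.cons (x := x) ht (.one le_rfl) (by simp)

lemma mul (hg : HasCost x L g r) (hh : HasCost x L h r') : HasCost x L (g * h) (r + r') := by
  induction hg with
  | one h0 => simpa using hh.weaken (by linarith)
  | cons ht _ h ih =>
    rw [mul_assoc]
    exact .cons ht ih (by linarith)

lemma inv (hL : ∀ i, ∀ t ∈ L i, t⁻¹ ∈ L i) (hg : HasCost x L g r) : HasCost x L g⁻¹ r := by
  induction hg with
  | one h0 => simpa using HasCost.one h0
  | cons ht _ h ih =>
    rw [mul_inv_rev]
    exact (ih.mul (letter (hL _ _ ht))).weaken (by linarith)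

lemma pow (hg : HasCost x L g r) (n : ℕ) : HasCost x L (g ^ n) (n * r) := by
  induction n with
  | zero => simpa using HasCost.one le_rfl
  | succ n ih =>
    rw [pow_succ]
    exact (ih.mul hg).weaken (by push_cast; linarith)

lemma conj {y : G} {δ : ℝ}
    (hL : ∀ j, ∀ o ∈ L j, HasCost x L (y * o * y⁻¹) (x ^ j * δ)) (hδ : 0 ≤ δ)
    (hg : HasCost x L g r) : HasCost x L (y * g * y⁻¹) (r * δ) := by
  induction hg with
  | one h0 => simpa using HasCost.one (mul_nonneg h0 hδ)
  | @cons i t g r r' ht _ h ih =>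
    have : y * (t * g) * y⁻¹ = (y * t * y⁻¹) * (y * g * y⁻¹) := by group
    rw [this]
    refine ((hL _ _ ht).mul ih).weaken ?_
    nlinarith [mul_le_mul_of_nonneg_right h hδ]

lemma inv_commutatorLetters {i : ℕ} (hg : HasCost x (commutatorLetters S i) g r) :
    HasCost x (commutatorLetters S i) g⁻¹ r :=
  hg.inv fun _ _ ht => ⟨ht.1, ht.2.inv⟩

lemma antitone {i j : ℕ} (hij : i ≤ j) (hg : HasCost x (commutatorLetters S j) g r) :
    HasCost x (commutatorLetters S i) g r :=
  hg.mono fun _ _ ht => ⟨hij.trans ht.1, ht.2⟩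

lemma commutatorLetters_of_generatorLetters (hg : HasCost x (generatorLetters S) g r) :
    HasCost x (commutatorLetters S 1) g r :=
  hg.mono (by rintro _ t ⟨rfl, ht⟩; exact ⟨le_rfl, .base ht⟩)

lemma conj_commutatorLetters (hx : 0 ≤ x) {i : ℕ} {y : G} {a : ℝ}
    (hy : HasCost x (commutatorLetters S 1) y a) (hg : HasCost x (commutatorLetters S i) g r) :
    HasCost x (commutatorLetters S i) (y * g * y⁻¹) (r * Real.exp a) := by
  induction hy with
  | one h0 =>
    simpa using hg.weaken (le_mul_of_one_le_right (hg.nonneg hx) (Real.one_le_exp h0))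
  | @cons k t y a a' ht hy h ih =>
    have e : t * y * g * (t * y)⁻¹ = t * (y * g * y⁻¹) * t⁻¹ := by group
    rw [e]
    refine (ih.conj (δ := 1 + x ^ k) (fun j o ho => ?_) (by positivity)).weaken ?_
    · have : t * o * t⁻¹ = ⁅t, o⁆ * o := by simp [commutatorElement_def]
      rw [this]
      have h1 : HasCost x (commutatorLetters S i) ⁅t, o⁆ (x ^ (k + j)) :=
        letter ⟨ho.1.trans (Nat.le_add_left _ _), ht.2.comm ho.2⟩
      exact (h1.mul (letter ho)).weaken (by rw [pow_add]; linarith)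
    · rw [mul_assoc]
      refine mul_le_mul_of_nonneg_left ?_ (hg.nonneg hx)
      calc Real.exp a * (1 + x ^ k) ≤ Real.exp a * Real.exp (x ^ k) := by
            gcongr
            linarith [Real.add_one_le_exp (x ^ k)]
        _ = Real.exp (a + x ^ k) := (Real.exp_add _ _).symm
        _ ≤ Real.exp a' := by
            gcongr
            linarith

lemma commutator_letter (hx : 0 ≤ x) {i k j : ℕ} {t : G} (hik : i ≤ k)
    (ht : IteratedCommutator S k t) (hj : 1 ≤ j) (hg : HasCost x (commutatorLetters S j) g r) :
    HasCost x (commutatorLetters S (i + j)) ⁅t, g⁆ (x ^ k * r * Real.exp r) := by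
  induction hg with
  | one h0 => simpa using HasCost.one (by positivity)
  | @cons l o g r r' ho hg h ih =>
    rw [commutatorElement_mul_right_eq_mul_conj]
    have h1 : HasCost x (commutatorLetters S (i + j)) ⁅t, o⁆ (x ^ (k + l)) :=
      letter ⟨add_le_add hik ho.1, ht.comm ho.2⟩
    have h2 := conj_commutatorLetters hx (y := o) (a := x ^ l)
      (letter ⟨hj.trans ho.1, ho.2⟩) ih
    have h3 := h1.mul h2
    rw [show ⁅t, o⁆ * (o * ⁅t, g⁆ * o⁻¹) = ⁅t, o⁆ * o * ⁅t, g⁆ * o⁻¹ by group] at h3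
    refine h3.weaken ?_
    have hr := hg.nonneg hx
    have e1 : Real.exp r * Real.exp (x ^ l) ≤ Real.exp r' := by
      rw [← Real.exp_add]
      gcongr
      linarith
    have e2 : (1 : ℝ) ≤ Real.exp r' := Real.one_le_exp (by have := pow_nonneg hx l; linarith)
    calc x ^ (k + l) + x ^ k * r * Real.exp r * Real.exp (x ^ l)
        = x ^ k * (x ^ l * 1 + r * (Real.exp r * Real.exp (x ^ l))) := by rw [pow_add]; ring
      _ ≤ x ^ k * (x ^ l * Real.exp r' + r * Real.exp r') := by gcongr
      _ = x ^ k * (x ^ l + r) * Real.exp r' := by ring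
      _ ≤ x ^ k * r' * Real.exp r' := by gcongr

lemma commutator (hx : 0 ≤ x) {i j : ℕ} {y : G} {a : ℝ} (hi : 1 ≤ i) (hj : 1 ≤ j)
    (hy : HasCost x (commutatorLetters S i) y a) (hg : HasCost x (commutatorLetters S j) g r) :
    HasCost x (commutatorLetters S (i + j)) ⁅y, g⁆ (a * r * Real.exp (a + r)) := by
  have hr := hg.nonneg hx
  induction hy with
  | one h0 => simpa using HasCost.one (by positivity)
  | @cons k t y a a' ht hy h ih =>
    rw [commutatorElement_mul_left_eq_conj_mul]
    have h1 := hg.commutator_letter hx ht.1 ht.2 hj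
    have h2 := conj_commutatorLetters hx (y := t) (a := x ^ k)
      (letter ⟨hi.trans ht.1, ht.2⟩) ih
    refine (h2.mul h1).weaken ?_
    have ha := hy.nonneg hx
    have hk := pow_nonneg hx k
    have e1 : Real.exp (a + r) * Real.exp (x ^ k) ≤ Real.exp (a' + r) := by
      rw [← Real.exp_add]
      exact Real.exp_le_exp.mpr (by linarith)
    have e2 : Real.exp r ≤ Real.exp (a' + r) := by
      exact Real.exp_le_exp.mpr (by linarith)
    calc a * r * Real.exp (a + r) * Real.exp (x ^ k) + x ^ k * r * Real.exp r
        = a * r * (Real.exp (a + r) * Real.exp (x ^ k)) + x ^ k * r * Real.exp r := by ring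
      _ ≤ a * r * Real.exp (a' + r) + x ^ k * r * Real.exp (a' + r) := by gcongr
      _ = (x ^ k + a) * r * Real.exp (a' + r) := by ring
      _ ≤ a' * r * Real.exp (a' + r) := by gcongr

end HasCost

lemma Subgroup.commutator_lowerCentralSeries_le (i j : ℕ) :
    ⁅(⊤ : Subgroup G).lowerCentralSeries i, (⊤ : Subgroup G).lowerCentralSeries j⁆ ≤
      (⊤ : Subgroup G).lowerCentralSeries (i + j + 1) := by
  induction j generalizing i with
  | zero => simp
  | succ j ih =>
    set N := (⊤ : Subgroup G).lowerCentralSeries (i + (j + 1) + 1) with hN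
    have key : ∀ A : Subgroup G, A.map (QuotientGroup.mk' N) = ⊥ ↔ A ≤ N := fun A => by
      rw [Subgroup.map_eq_bot_iff, QuotientGroup.ker_mk']
    rw [Subgroup.lowerCentralSeries_succ, Subgroup.commutator_comm, ← key, Subgroup.map_commutator,
      Subgroup.map_commutator]
    apply Subgroup.commutator_commutator_eq_bot_of_rotate
    · rw [← Subgroup.map_commutator, ← Subgroup.map_commutator, key, Subgroup.commutator_comm ⊤,
        ← Subgroup.lowerCentralSeries_succ]
      exact (ih (i + 1)).trans (le_of_eq (by rw [hN]; congr 1; omega))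
    · rw [← Subgroup.map_commutator, ← Subgroup.map_commutator, key]
      refine (Subgroup.commutator_mono (ih i) le_rfl).trans (le_of_eq ?_)
      rw [← Subgroup.lowerCentralSeries_succ, hN]
      congr 1

lemma IteratedCommutator.mem_lowerCentralSeries {S : Set G} {i : ℕ} {g : G}
    (h : IteratedCommutator S i g) : g ∈ (⊤ : Subgroup G).lowerCentralSeries (i - 1) := by
  induction h with
  | base _ => simp
  | @comm i j a b ha hb iha ihb =>
    have := Subgroup.commutator_lowerCentralSeries_le _ _
      (Subgroup.commutator_mem_commutator iha ihb)
    have hi := ha.pos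
    have hj := hb.pos
    rwa [show i + j - 1 = i - 1 + (j - 1) + 1 by omega]
  | inv _ ih => exact inv_mem ih

lemma exists_iteratedCommutator_eq_one [Group.IsNilpotent G] (S : Set G) :
    ∃ c : ℕ, ∀ i g, c < i → IteratedCommutator S i g → g = 1 := by
  obtain ⟨c, hc⟩ := Subgroup.nilpotent_iff_lowerCentralSeries.mp ‹Group.IsNilpotent G›
  refine ⟨c, fun i g hi hg => ?_⟩
  have := Subgroup.lowerCentralSeries_antitone ⊤ (show c ≤ i - 1 by omega)
    hg.mem_lowerCentralSeries
  rwa [hc, Subgroup.mem_bot] at this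

lemma finite_iteratedCommutator {S : Set G} (hS : S.Finite) (i : ℕ) :
    {g | IteratedCommutator S i g}.Finite := by
  induction i using Nat.strong_induction_on with
  | _ i ih =>
    set C : Set G := ⋃ j ∈ Finset.range i, ⋃ k ∈ Finset.range i,
      {g | j < i ∧ k < i ∧ ∃ a, IteratedCommutator S j a ∧ ∃ b, IteratedCommutator S k b ∧
        ⁅a, b⁆ = g} with hC
    have hCfin : C.Finite := by
      refine Set.Finite.biUnion (Finset.finite_toSet _) fun j hj =>
        Set.Finite.biUnion (Finset.finite_toSet _) fun k hk => ?_
      refine (Set.Finite.image2 (fun a b => ⁅a, b⁆) (ih j (by simpa using hj))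
        (ih k (by simpa using hk))).subset ?_
      rintro g ⟨_, _, a, ha, b, hb, rfl⟩
      exact ⟨a, ha, b, hb, rfl⟩
    have key : ∀ g, IteratedCommutator S i g → g ∈ (S ∪ C) ∪ (S ∪ C)⁻¹ := fun g hg => by
      clear_value C
      induction hg with
      | base hs => exact .inl (.inl hs)
      | @comm j k a b ha hb _ _ =>
        refine .inl (.inr ?_)
        have hj := ha.pos
        have hk := hb.pos
        simp only [hC, Set.mem_iUnion]
        exact ⟨j, by simp; omega, k, by simp; omega, by omega, by omega, a, ha, b, hb, rfl⟩
      | inv _ h =>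
        rcases h ih hC with h | h
        · exact .inr (by simpa using h)
        · exact .inl (by simpa using h)
    exact (((hS.union hCfin).union (hS.union hCfin).inv)).subset key

namespace HasCost

variable {x : ℝ} {S : Set G} {g : G} {r : ℝ}

/-- Multiplying the scale `x` by `lam ≥ 1` multiplies the cost by at most `lam ^ c` when all
iterated commutators of weight more than `c` are trivial. -/
lemma rescale (hx : 0 ≤ x) {lam : ℝ} (hlam : 1 ≤ lam) {c : ℕ}
    (hc : ∀ i g, c < i → IteratedCommutator S i g → g = 1)
    (hg : HasCost x (commutatorLetters S 1) g r) :
    HasCost (lam * x) (commutatorLetters S 1) g (lam ^ c * r) := by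
  induction hg with
  | one h0 => exact .one (by positivity)
  | @cons k t g r r' ht hg h ih =>
    have hk := pow_nonneg hx k
    have hl : 0 ≤ lam ^ c := by positivity
    by_cases hkc : c < k
    · rw [hc k t hkc ht.2, one_mul]
      exact ih.weaken (by gcongr; linarith)
    · refine .cons ht ih ?_
      have : lam ^ k ≤ lam ^ c := pow_le_pow_right₀ hlam (by omega)
      calc (lam * x) ^ k + lam ^ c * r = lam ^ k * x ^ k + lam ^ c * r := by rw [mul_pow]
        _ ≤ lam ^ c * x ^ k + lam ^ c * r := by gcongr
        _ = lam ^ c * (x ^ k + r) := by ring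
        _ ≤ lam ^ c * r' := by gcongr

/-- If `⁅a, y⁆ = τ * v` with `v` of higher weight than `τ`, then `⁅a ^ p, y⁆` agrees with `τ ^ p`
up to a controlled product of letters of higher weight. -/
lemma pow_commutator (hx : 0 ≤ x) {i k : ℕ} {a y τ v : G} {A α ρ β : ℝ}
    (ha : IteratedCommutator S i a) (hk : 1 ≤ k) (hay : ⁅a, y⁆ = τ * v)
    (hτ : HasCost x (commutatorLetters S k) τ α) (hv : HasCost x (commutatorLetters S (k + 1)) v ρ)
    (hA : 0 ≤ A) (hβ : 0 ≤ β) (hxi : x ^ i ≤ A) (hαA : α ≤ A) {p : ℕ}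
    (hpx : p * x ^ i ≤ A) (hpα : p * α ≤ A * β) (hpα' : p * α ≤ A) (hpρ : p * ρ ≤ A * β) :
    ∃ z, ⁅a ^ p, y⁆ = τ ^ p * z ∧
      HasCost x (commutatorLetters S (k + 1)) z
        ((A * A * Real.exp (3 * A) + A) * Real.exp (2 * A) * β) := by
  have hi := ha.pos
  have hα := hτ.nonneg hx
  have hρ := hv.nonneg hx
  have hxi0 := pow_nonneg hx i
  set η : ℝ := p * α * x ^ i * Real.exp (3 * A) + ρ with hη
  have hη0 : 0 ≤ η := by positivity
  set δ : ℝ := α + x ^ i with hδ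
  have hδ0 : 0 ≤ δ := by positivity
  have main : ∀ q : ℕ, q ≤ p → ∃ z, ⁅a ^ q, y⁆ = τ ^ q * z ∧
      HasCost x (commutatorLetters S (k + 1)) z (q * η * Real.exp (q * δ)) := by
    intro q hq
    induction q with
    | zero => exact ⟨1, by simp, .one (by simp)⟩
    | succ q ih =>
      obtain ⟨z, hz, hzc⟩ := ih (by omega)
      have hqp : (q : ℝ) ≤ p := by exact_mod_cast (by omega : q ≤ p)
      have hqα : (q : ℝ) * α ≤ p * α := by gcongr
      refine ⟨τ⁻¹ * (⁅(τ ^ q)⁻¹, a⁆ * (a * z * a⁻¹)) * τ⁻¹⁻¹ * v, ?_, ?_⟩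
      · rw [pow_succ', commutatorElement_mul_left_eq_conj_mul, hz, hay, pow_succ,
          commutatorElement_def]
        group
      · have hal : HasCost x (commutatorLetters S 1) a (x ^ i) := letter ⟨hi, ha⟩
        have h1 : HasCost x (commutatorLetters S (k + 1)) ⁅(τ ^ q)⁻¹, a⁆
            (q * α * x ^ i * Real.exp (q * α + x ^ i)) :=
          (hτ.pow q).inv_commutatorLetters.commutator hx hk le_rfl hal
        have h2 := conj_commutatorLetters hx hal hzc
        have h3 := conj_commutatorLetters hx
          (hτ.inv_commutatorLetters.antitone hk) (h1.mul h2)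
        refine (h3.mul hv).weaken ?_
        have e1 : q * α * x ^ i * Real.exp (q * α + x ^ i) * Real.exp α ≤
            p * α * x ^ i * Real.exp (3 * A) := by
          rw [mul_assoc _ (Real.exp _), ← Real.exp_add]
          gcongr
          linarith
        have e2 : q * η * Real.exp (q * δ) * Real.exp (x ^ i) * Real.exp α =
            q * η * Real.exp ((q + 1) * δ) := by
          rw [mul_assoc, mul_assoc, ← Real.exp_add, ← Real.exp_add]
          congr 2
          rw [hδ]
          ring
        have e3 : (1 : ℝ) ≤ Real.exp ((q + 1) * δ) := Real.one_le_exp (by positivity)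
        calc (q * α * x ^ i * Real.exp (q * α + x ^ i) +
              q * η * Real.exp (q * δ) * Real.exp (x ^ i)) * Real.exp α + ρ
            = q * α * x ^ i * Real.exp (q * α + x ^ i) * Real.exp α + ρ +
              q * η * Real.exp (q * δ) * Real.exp (x ^ i) * Real.exp α := by ring
          _ ≤ η + q * η * Real.exp ((q + 1) * δ) := by rw [e2]; gcongr; linarith
          _ ≤ η * Real.exp ((q + 1) * δ) + q * η * Real.exp ((q + 1) * δ) := by
            gcongr
            exact le_mul_of_one_le_right hη0 e3
          _ = (q + 1 : ℕ) * η * Real.exp ((q + 1 : ℕ) * δ) := by push_cast; ring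
  obtain ⟨z, hz, hzc⟩ := main p le_rfl
  refine ⟨z, hz, hzc.weaken ?_⟩
  have e1 : Real.exp (p * δ) ≤ Real.exp (2 * A) := by
    apply Real.exp_le_exp.mpr
    rw [hδ]
    linarith
  have e2 : p * η ≤ (A * A * Real.exp (3 * A) + A) * β := by
    calc p * η = (p * x ^ i) * (p * α) * Real.exp (3 * A) + p * ρ := by rw [hη]; ring
      _ ≤ A * (A * β) * Real.exp (3 * A) + A * β := by gcongr
      _ = _ := by ring
  calc p * η * Real.exp (p * δ) ≤ (A * A * Real.exp (3 * A) + A) * β * Real.exp (2 * A) := by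
        gcongr
    _ = _ := by ring

/-- Commutators are bilinear up to controlled products of letters of higher weight. -/
lemma exists_pow_commutator_pow {i j : ℕ} {a b : G} (ha : IteratedCommutator S i a)
    (hb : IteratedCommutator S j b) {A : ℝ} (hA : 1 ≤ A) :
    ∃ C, ∀ x : ℝ, 0 ≤ x → x ≤ 1 → ∀ p q : ℕ, p * x ^ i ≤ A → q * x ^ j ≤ A →
      ∃ z, ⁅a ^ p, b ^ q⁆ = ⁅a, b⁆ ^ (p * q) * z ∧
        HasCost x (commutatorLetters S (i + j + 1)) z C := by
  have hA0 : 0 ≤ A := by linarith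
  set F : ℝ := (A * A * Real.exp (3 * A) + A) * Real.exp (2 * A) with hF
  have hF0 : 0 ≤ F := by positivity
  set A' : ℝ := A * A + A * (F * Real.exp A) with hA'
  have hA'0 : 0 ≤ A' := by positivity
  refine ⟨(A' * A' * Real.exp (3 * A') + A') * Real.exp (2 * A') * 1, fun x hx hx1 p q hp hq => ?_⟩
  have hxi := pow_nonneg hx i
  have hxi1 : x ^ i ≤ 1 := pow_le_one₀ hx hx1
  have hxj := pow_nonneg hx j
  have hxj1 : x ^ j ≤ 1 := pow_le_one₀ hx hx1
  have hij : 1 ≤ i + j := le_add_right ha.pos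
  have ht : HasCost x (commutatorLetters S (i + j)) ⁅a, b⁆ (x ^ (i + j)) :=
    letter ⟨le_rfl, ha.comm hb⟩
  have hqij : q * x ^ (i + j) ≤ A * x ^ i := by
    calc q * x ^ (i + j) = q * x ^ j * x ^ i := by ring
      _ ≤ A * x ^ i := by gcongr
  have hqij' : q * x ^ (i + j) ≤ A := hqij.trans (by nlinarith)
  obtain ⟨z, hz, hzc⟩ := pow_commutator (A := A) (β := x ^ i) (p := q) (v := 1) (ρ := 0) hx hb hij
    (by rw [mul_one, commutatorElement_inv]) ht.inv_commutatorLetters (.one le_rfl) hA0 hxi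
    (hxj1.trans hA) ((pow_le_one₀ hx hx1).trans hA) hq hqij hqij'
    (by simpa using mul_nonneg hA0 hxi)
  rw [← hF] at hzc
  have hab : ⁅a, b ^ q⁆ = ⁅a, b⁆ ^ q * ((⁅a, b⁆ ^ q)⁻¹ * z⁻¹ * (⁅a, b⁆ ^ q)⁻¹⁻¹) := by
    rw [← commutatorElement_inv, hz]
    generalize ⁅a, b⁆ = t
    group
  have hv := conj_commutatorLetters hx ((ht.pow q).inv_commutatorLetters.antitone hij)
    hzc.inv_commutatorLetters
  have hv' : HasCost x (commutatorLetters S (i + j + 1))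
      ((⁅a, b⁆ ^ q)⁻¹ * z⁻¹ * (⁅a, b⁆ ^ q)⁻¹⁻¹) (F * Real.exp A * x ^ i) := by
    refine hv.weaken ?_
    calc F * x ^ i * Real.exp (q * x ^ (i + j)) ≤ F * x ^ i * Real.exp A := by gcongr
      _ = _ := by ring
  have hFA : 0 ≤ F * Real.exp A := by positivity
  have hAA : A ≤ A * A := by nlinarith
  have hAF : 0 ≤ A * (F * Real.exp A) := by positivity
  have hpq : p * (q * x ^ (i + j)) ≤ A * A :=
    calc p * (q * x ^ (i + j)) ≤ p * (A * x ^ i) := by gcongr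
      _ = A * (p * x ^ i) := by ring
      _ ≤ A * A := by gcongr
  obtain ⟨w, hw, hwc⟩ := pow_commutator (A := A') (β := 1) (p := p) hx ha hij hab (ht.pow q) hv'
    hA'0 zero_le_one (by rw [hA']; linarith) (by rw [hA']; linarith) (by rw [hA']; linarith)
    (by rw [hA']; linarith) (by rw [hA']; linarith)
    (by
      calc p * (F * Real.exp A * x ^ i) = (p * x ^ i) * (F * Real.exp A) := by ring
        _ ≤ A * (F * Real.exp A) := by gcongr
        _ ≤ A' * 1 := by rw [hA']; nlinarith)
  exact ⟨w, by rw [hw, mul_comm p q, pow_mul], hwc⟩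

end HasCost

lemma HasCost.inv_generatorLetters {x : ℝ} {S : Set G} {g : G} {r : ℝ} (hS : ∀ s ∈ S, s⁻¹ ∈ S)
    (hg : HasCost x (generatorLetters S) g r) : HasCost x (generatorLetters S) g⁻¹ r :=
  hg.inv fun _ _ ht => ⟨ht.1, hS _ ht.2⟩

/-- `SplitCost x S k g C`: the element `g` is a word of cost at most `C` in the generators times
a word of cost at most `C` in the iterated commutators of weight at least `k`. -/
def SplitCost (x : ℝ) (S : Set G) (k : ℕ) (g : G) (C : ℝ) : Prop :=
  ∃ p v, g = p * v ∧ HasCost x (generatorLetters S) p C ∧ HasCost x (commutatorLetters S k) v C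

namespace SplitCost

variable {x : ℝ} {S : Set G} {k : ℕ} {g h : G} {C D : ℝ}

lemma of_commutatorLetters (hx : 0 ≤ x) (hg : HasCost x (commutatorLetters S k) g C) :
    SplitCost x S k g C :=
  ⟨1, g, by simp, .one (hg.nonneg hx), hg⟩

lemma weaken (hg : SplitCost x S k g C) (h : C ≤ D) : SplitCost x S k g D := by
  obtain ⟨p, v, e, hp, hv⟩ := hg
  exact ⟨p, v, e, hp.weaken h, hv.weaken h⟩

lemma mul (hS : ∀ s ∈ S, s⁻¹ ∈ S) (hx : 0 ≤ x) (hg : SplitCost x S k g C)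
    (hh : SplitCost x S k h D) : SplitCost x S k (g * h) (C * Real.exp D + C + D) := by
  obtain ⟨p, v, rfl, hp, hv⟩ := hg
  obtain ⟨q, w, rfl, hq, hw⟩ := hh
  have hC := hp.nonneg hx
  have hD := hq.nonneg hx
  have h1 := HasCost.conj_commutatorLetters hx
    (hq.inv_generatorLetters hS).commutatorLetters_of_generatorLetters hv
  refine ⟨p * q, q⁻¹ * v * q⁻¹⁻¹ * w, by group, (hp.mul hq).weaken ?_, (h1.mul hw).weaken ?_⟩
  · nlinarith [mul_nonneg hC (Real.exp_pos D).le]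
  · linarith

lemma inv (hS : ∀ s ∈ S, s⁻¹ ∈ S) (hx : 0 ≤ x) (hg : SplitCost x S k g C) :
    SplitCost x S k g⁻¹ (C * Real.exp C) := by
  obtain ⟨p, v, rfl, hp, hv⟩ := hg
  have hC := hp.nonneg hx
  refine ⟨p⁻¹, p * v⁻¹ * p⁻¹, by group, (hp.inv_generatorLetters hS).weaken ?_,
    HasCost.conj_commutatorLetters hx hp.commutatorLetters_of_generatorLetters
      hv.inv_commutatorLetters⟩
  exact le_mul_of_one_le_right hC (Real.one_le_exp hC)

lemma of_generatorLetters (hx : 0 ≤ x) (hg : HasCost x (generatorLetters S) g C) :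
    SplitCost x S k g C :=
  ⟨g, 1, by simp, hg, .one (hg.nonneg hx)⟩

lemma exists_commutator (hS : ∀ s ∈ S, s⁻¹ ∈ S) {i j : ℕ} (hi : 1 ≤ i) (hj : 1 ≤ j) (C E : ℝ) :
    ∃ D, ∀ x : ℝ, 0 ≤ x → ∀ g h : G, SplitCost x S (i + 1) g C → SplitCost x S (j + 1) h C →
      HasCost x (commutatorLetters S i) g E → HasCost x (commutatorLetters S j) h E →
      SplitCost x S (i + j + 1) ⁅g, h⁆ D := by
  apply Exists.intro
  intro x hx g h hg hh hgE hhE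
  obtain ⟨p, v, rfl, hp, hv⟩ := hg
  obtain ⟨q, w, rfl, hq, hw⟩ := hh
  have e : ⁅p * v, q * w⁆ = p * ⁅v, q * w⁆ * p⁻¹ * (⁅p, q⁆ * (q * ⁅p, w⁆ * q⁻¹)) := by
    simp only [commutatorElement_def]; group
  have hpi : HasCost x (commutatorLetters S i) p (E + C) := by
    simpa using hgE.mul (hv.antitone i.le_succ).inv_commutatorLetters
  have h1 := HasCost.conj_commutatorLetters hx hp.commutatorLetters_of_generatorLetters
    (hv.commutator hx (by omega) hj hhE)
  have h2 := HasCost.conj_commutatorLetters hx hq.commutatorLetters_of_generatorLetters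
    (hpi.commutator hx hi (by omega) hw)
  have h3 := ((hp.mul hq).mul (hp.inv_generatorLetters hS)).mul (hq.inv_generatorLetters hS)
  rw [← commutatorElement_def] at h3
  rw [e]
  exact (of_commutatorLetters hx (h1.antitone (by omega))).mul hS hx
    ((of_generatorLetters hx h3).mul hS hx (of_commutatorLetters hx h2))

lemma exists_pow (hS : ∀ s ∈ S, s⁻¹ ∈ S) {i : ℕ} {t : G} (ht : IteratedCommutator S i t) (A : ℝ) :
    ∃ C, ∀ n : ℕ, 1 ≤ n → ∀ m : ℕ, m * (n : ℝ)⁻¹ ^ i ≤ A →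
      SplitCost (n : ℝ)⁻¹ S (i + 1) (t ^ m) C := by
  induction ht generalizing A with
  | base hs =>
    refine ⟨A, fun n _ m hm => of_generatorLetters (by positivity) ?_⟩
    simpa using ((HasCost.letter (L := generatorLetters S) ⟨rfl, hs⟩).pow m).weaken hm
  | inv _ ih =>
    obtain ⟨C, hC⟩ := ih A
    apply Exists.intro
    intro n hn m hm
    rw [inv_pow]
    exact (hC n hn m hm).inv hS (by positivity)
  | @comm i j a b ha hb iha ihb =>
    wlog hA : 1 ≤ A generalizing A
    · obtain ⟨C, hC⟩ := this 1 le_rfl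
      exact ⟨C, fun n hn m hm => hC n hn m (by linarith)⟩
    obtain ⟨C₁, hC₁⟩ := iha A
    obtain ⟨C₂, hC₂⟩ := ihb A
    obtain ⟨D, hD⟩ := exists_commutator hS ha.pos hb.pos (max C₁ C₂) A
    obtain ⟨Z, hZ⟩ := HasCost.exists_pow_commutator_pow ha hb hA
    have key : ∃ E, ∀ n : ℕ, 1 ≤ n → ∀ p q : ℕ, p * (n : ℝ)⁻¹ ^ i ≤ A → q * (n : ℝ)⁻¹ ^ j ≤ A →
        SplitCost (n : ℝ)⁻¹ S (i + j + 1) (⁅a, b⁆ ^ (p * q)) E := by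
      apply Exists.intro
      intro n hn p q hp hq
      have hn' : (1 : ℝ) ≤ n := by exact_mod_cast hn
      have hx : (0 : ℝ) ≤ (n : ℝ)⁻¹ := by positivity
      obtain ⟨z, hz, hzc⟩ := hZ _ hx (inv_le_one_of_one_le₀ hn') p q hp hq
      rw [eq_mul_inv_of_mul_eq hz.symm]
      exact (hD _ hx (a ^ p) (b ^ q) ((hC₁ n hn p hp).weaken (le_max_left _ _))
        ((hC₂ n hn q hq).weaken (le_max_right _ _))
        (((HasCost.letter (L := commutatorLetters S i) ⟨le_rfl, ha⟩).pow p).weaken hp)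
        (((HasCost.letter (L := commutatorLetters S j) ⟨le_rfl, hb⟩).pow q).weaken hq)).mul hS hx
        (of_commutatorLetters hx hzc.inv_commutatorLetters)
    obtain ⟨E, hE⟩ := key
    apply Exists.intro
    intro n hn m hm
    have hn' : (1 : ℝ) ≤ n := by exact_mod_cast hn
    have hn0 : (0 : ℝ) < n := by linarith
    have hx : (0 : ℝ) ≤ (n : ℝ)⁻¹ := by positivity
    have hx1 : (n : ℝ)⁻¹ ≤ 1 := inv_le_one_of_one_le₀ hn'
    have hm1 : m = m / n ^ j * n ^ j + 1 * (m % n ^ j) := by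
      rw [one_mul, Nat.div_add_mod']
    rw [hm1, pow_add]
    have hj : (n : ℝ) ^ j * (n : ℝ)⁻¹ ^ j = 1 := by
      rw [← mul_pow, mul_inv_cancel₀ hn0.ne', one_pow]
    have hxj : 0 < (n : ℝ)⁻¹ ^ j := by positivity
    refine (hE n hn _ _ ?_ ?_).mul hS hx (hE n hn _ _ ?_ ?_)
    · refine le_trans ?_ hm
      have h1 : ((m / n ^ j : ℕ) : ℝ) * (n : ℝ) ^ j ≤ m := by
        exact_mod_cast Nat.div_mul_le_self _ _
      calc ((m / n ^ j : ℕ) : ℝ) * (n : ℝ)⁻¹ ^ i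
          = ((m / n ^ j : ℕ) : ℝ) * (n : ℝ) ^ j * ((n : ℝ)⁻¹ ^ i * (n : ℝ)⁻¹ ^ j) := by
            linear_combination (-((m / n ^ j : ℕ) : ℝ) * (n : ℝ)⁻¹ ^ i) * hj
        _ ≤ m * (n : ℝ)⁻¹ ^ (i + j) := by
            rw [pow_add]
            gcongr
    · push_cast
      rw [hj]
      exact hA
    · rw [Nat.cast_one, one_mul]
      exact (pow_le_one₀ hx hx1).trans hA
    · refine le_trans ?_ hA
      rw [← hj]
      have : (m % n ^ j : ℕ) ≤ n ^ j := (Nat.mod_lt _ (by positivity)).le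
      gcongr
      exact_mod_cast this

end SplitCost

/-- The elements of `R` as letters of weight `i`, together with the iterated commutators of weight
more than `i`. -/
def partialLetters (S : Set G) (i : ℕ) (R : Set G) : ℕ → Set G :=
  fun j => {t | j = i ∧ t ∈ R ∨ t ∈ commutatorLetters S (i + 1) j}

namespace HasCost

lemma exists_eq_pow_mul {x : ℝ} (hx : 0 ≤ x) {S R : Set G} {i : ℕ} {t g : G} {r A : ℝ}
    (ht : IteratedCommutator S i t) (hR : ∀ a ∈ R, IteratedCommutator S i a)
    (hg : HasCost x (partialLetters S i (insert t R)) g r) (hr : r ≤ A) :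
    ∃ (m : ℕ) (v : G), g = t ^ m * v ∧ m * x ^ i ≤ r ∧
      HasCost x (partialLetters S i R) v (r * (1 + A * Real.exp (2 * A))) := by
  induction hg with
  | @one r h0 => exact ⟨0, 1, by simp, by simpa, .one (by have := h0.trans hr; positivity)⟩
  | @cons l o g r r' ho hg h ih =>
    have hxl : 0 ≤ x ^ l := pow_nonneg hx l
    have hr0 := hg.nonneg hx
    have hA : 0 ≤ A := by linarith
    obtain ⟨m, v, rfl, hm, hv⟩ := ih (by linarith)
    have hF : 0 ≤ A * Real.exp (2 * A) := by positivity
    by_cases hot : l = i ∧ o = t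
    · obtain ⟨rfl, rfl⟩ := hot
      refine ⟨m + 1, v, by rw [pow_succ', mul_assoc], by push_cast; linarith, hv.weaken ?_⟩
      nlinarith
    have ho' : o ∈ partialLetters S i R l := by
      rcases ho with ⟨hl, ho | ho⟩ | ho
      · exact absurd ⟨hl, ho⟩ hot
      · exact .inl ⟨hl, ho⟩
      · exact .inr ho
    have ho1 : IteratedCommutator S l o := by
      rcases ho' with ⟨rfl, h⟩ | ho
      · exact hR _ h
      · exact ho.2
    have hc : HasCost x (partialLetters S i R) ⁅(t ^ m)⁻¹, o⁆ (x ^ l * (A * Real.exp (2 * A))) := by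
      refine HasCost.mono (L := commutatorLetters S (i + 1)) (fun _ _ h => .inr h) ?_
      refine (HasCost.commutator hx ht.pos le_rfl (((HasCost.letter (x := x)
        (L := commutatorLetters S i) ⟨le_rfl, ht⟩).pow m).inv_commutatorLetters)
        (HasCost.letter (x := x) (L := commutatorLetters S 1) ⟨ho1.pos, ho1⟩)).weaken ?_
      have h1 : m * x ^ i ≤ A := by linarith
      have h2 : m * x ^ i + x ^ l ≤ 2 * A := by linarith
      calc _ = x ^ l * (m * x ^ i * Real.exp (m * x ^ i + x ^ l)) := by ring
        _ ≤ _ := by gcongr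
    refine ⟨m, ⁅(t ^ m)⁻¹, o⁆ * o * v, by rw [commutatorElement_def]; group, by linarith,
      ((hc.mul (.letter ho')).mul hv).weaken ?_⟩
    nlinarith

lemma exists_generatorLetters [Group.IsNilpotent G] {S : Set G} (hSfin : S.Finite)
    (hS : ∀ s ∈ S, s⁻¹ ∈ S) (A : ℝ) :
    ∃ C, ∀ n : ℕ, 1 ≤ n → ∀ g : G, HasCost (n : ℝ)⁻¹ (commutatorLetters S 1) g A →
      HasCost (n : ℝ)⁻¹ (generatorLetters S) g C := by
  obtain ⟨c, hc⟩ := exists_iteratedCommutator_eq_one S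
  suffices H : ∀ d i : ℕ, c + 1 ≤ i + d → ∀ A : ℝ, ∃ C, ∀ n : ℕ, 1 ≤ n → ∀ g : G,
      HasCost (n : ℝ)⁻¹ (commutatorLetters S i) g A → HasCost (n : ℝ)⁻¹ (generatorLetters S) g C
    from H c 1 (by omega) A
  intro d
  induction d with
  | zero =>
    refine fun i hi A => ⟨A, fun n _ g hg => ?_⟩
    have h0 : (0 : ℝ) ≤ (n : ℝ)⁻¹ := by positivity
    have : g = 1 := by
      induction hg with
      | one _ => rfl
      | cons ht _ _ ih => rw [hc _ _ (lt_of_lt_of_le (by omega) ht.1) ht.2, ih, mul_one]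
    rw [this]
    exact .one (hg.nonneg h0)
  | succ d ihd =>
    intro i hi A
    have key : ∀ R : Set G, R.Finite → (∀ a ∈ R, IteratedCommutator S i a) → ∀ A : ℝ, ∃ C,
        ∀ n : ℕ, 1 ≤ n → ∀ g : G, HasCost (n : ℝ)⁻¹ (partialLetters S i R) g A →
          HasCost (n : ℝ)⁻¹ (generatorLetters S) g C := by
      intro R hR
      induction R, hR using Set.Finite.induction_on with
      | empty =>
        intro _ A
        obtain ⟨C, hC⟩ := ihd (i + 1) (by omega) A
        exact ⟨C, fun n hn g hg => hC n hn g (hg.mono fun _ _ h => h.resolve_left (by simp))⟩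
      | @insert t R _ _ ihR =>
        intro hR A
        have ht := hR t (Set.mem_insert _ _)
        have hR' : ∀ a ∈ R, IteratedCommutator S i a := fun a ha => hR a (Set.mem_insert_of_mem _ ha)
        obtain ⟨C₁, hC₁⟩ := SplitCost.exists_pow hS ht A
        obtain ⟨C₂, hC₂⟩ := ihd (i + 1) (by omega) C₁
        obtain ⟨C₃, hC₃⟩ := ihR hR' (A * (1 + A * Real.exp (2 * A)))
        refine ⟨C₁ + C₂ + C₃, fun n hn g hg => ?_⟩
        obtain ⟨m, v, rfl, hm, hv⟩ := exists_eq_pow_mul (by positivity) ht hR' hg le_rfl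
        obtain ⟨p, w, hpw, hp, hw⟩ := hC₁ n hn m hm
        rw [hpw]
        exact (hp.mul (hC₂ n hn w hw)).mul (hC₃ n hn v hv)
    obtain ⟨C, hC⟩ := key _ (finite_iteratedCommutator hSfin i) (fun _ h => h) A
    refine ⟨C, fun n hn g hg => hC n hn g (hg.mono fun j t ht => ?_)⟩
    rcases ht.1.eq_or_lt with rfl | h
    · exact .inl ⟨rfl, ht.2⟩
    · exact .inr ⟨h, ht.2⟩

end HasCost

lemma HasCost.exists_list {S : Set G} {n : ℕ} (hn : 1 ≤ n) {g : G} {r : ℝ}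
    (hg : HasCost (n : ℝ)⁻¹ (generatorLetters S) g r) :
    ∃ l : List G, (∀ s ∈ l, s ∈ S) ∧ l.prod = g ∧ (l.length : ℝ) ≤ n * r := by
  have hn' : (1 : ℝ) ≤ n := by exact_mod_cast hn
  induction hg with
  | one h0 => exact ⟨[], by simp, rfl, by simp only [List.length_nil, Nat.cast_zero]; positivity⟩
  | @cons i t g r r' ht _ h ih =>
    obtain ⟨rfl, ht⟩ := ht
    obtain ⟨l, hl, rfl, hlen⟩ := ih
    refine ⟨t :: l, by simpa using ⟨ht, hl⟩, by simp, ?_⟩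
    have : (n : ℝ) * (n : ℝ)⁻¹ = 1 := mul_inv_cancel₀ (by positivity)
    rw [pow_one] at h
    push_cast [List.length_cons]
    nlinarith [mul_le_mul_of_nonneg_left h (by positivity : (0 : ℝ) ≤ n)]

lemma HasCost.list_prod {S : Set G} {x : ℝ} {l : List G} (hl : ∀ s ∈ l, s ∈ S) :
    HasCost x (commutatorLetters S 1) l.prod (l.length * x) := by
  induction l with
  | nil => simpa using HasCost.one le_rfl
  | cons s l ih =>
    rw [List.forall_mem_cons] at hl
    rw [List.prod_cons]
    refine .cons (i := 1) ⟨le_rfl, .base hl.1⟩ (ih hl.2) ?_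
    push_cast [List.length_cons]
    linarith

/-- In a finitely generated nilpotent group, the word length of the conjugates of a fixed element
by `g` grows sublinearly in the length of `g`. -/
lemma exists_list_prod_eq_conj [Group.IsNilpotent G] {S : Set G} (hSfin : S.Finite)
    (hS : ∀ s ∈ S, s⁻¹ ∈ S) {k : List G} (hk : ∀ s ∈ k, s ∈ S) {ε : ℝ} (hε : 0 < ε) :
    ∃ B : ℝ, ∀ l : List G, (∀ s ∈ l, s ∈ S) → ∃ l' : List G, (∀ s ∈ l', s ∈ S) ∧
      l'.prod = l.prod * k.prod * l.prod⁻¹ ∧ (l'.length : ℝ) ≤ ε * l.length + B := by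
  obtain ⟨c, hc⟩ := exists_iteratedCommutator_eq_one S
  obtain ⟨C, hC⟩ := HasCost.exists_generatorLetters hSfin hS 1
  obtain ⟨p, hp⟩ := exists_nat_ge (|C| / ε)
  obtain ⟨b, hb⟩ := exists_nat_ge (((p + 1 : ℕ) : ℝ) ^ c * (k.length * Real.exp 1))
  refine ⟨(b + 1) * |C|, fun l hl => ?_⟩
  set q : ℕ := p + 1 with hq
  set n : ℕ := l.length / q + b + 1 with hn
  have hq0 : (1 : ℝ) ≤ q := by exact_mod_cast Nat.le_add_left 1 p
  have hn0 : (1 : ℝ) ≤ n := by exact_mod_cast Nat.le_add_left 1 _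
  have hn1 : 1 ≤ n := Nat.le_add_left 1 _
  have hlen : (l.length : ℝ) ≤ q * n := by
    have h1 : l.length < q * (l.length / q + 1) := Nat.lt_mul_div_succ _ (by omega)
    have h2 : q * (l.length / q + 1) ≤ q * n := Nat.mul_le_mul_left _ (by omega)
    exact_mod_cast h1.le.trans h2
  have hqn : (0 : ℝ) < q * n := by positivity
  have hx : (0 : ℝ) ≤ ((q : ℝ) * n)⁻¹ := by positivity
  have h1 : HasCost ((q : ℝ) * n)⁻¹ (commutatorLetters S 1) l.prod 1 :=
    (HasCost.list_prod hl).weaken (by rw [← div_eq_mul_inv]; exact div_le_one_of_le₀ hlen hqn.le)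
  have h2 := (HasCost.conj_commutatorLetters hx h1 (HasCost.list_prod hk)).rescale hx hq0 hc
  have h3 : (q : ℝ) * ((q : ℝ) * n)⁻¹ = (n : ℝ)⁻¹ := by field_simp
  have h4 : (q : ℝ) ^ c * (k.length * ((q : ℝ) * n)⁻¹ * Real.exp 1) ≤ 1 := by
    have hbn : (b : ℝ) ≤ q * n := by
      have : (b : ℝ) ≤ n := by exact_mod_cast (Nat.le_add_left _ _).trans (Nat.le_succ (l.length / q + b))
      nlinarith
    calc (q : ℝ) ^ c * (k.length * ((q : ℝ) * n)⁻¹ * Real.exp 1)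
        = (q : ℝ) ^ c * (k.length * Real.exp 1) / (q * n) := by rw [div_eq_mul_inv]; ring
      _ ≤ 1 := div_le_one_of_le₀ (hb.trans hbn) hqn.le
  rw [h3] at h2
  obtain ⟨l', hl', hprod, hlen'⟩ :=
    ((hC n hn1 _ (h2.weaken h4)).weaken (le_abs_self C)).exists_list hn1
  refine ⟨l', hl', hprod, hlen'.trans ?_⟩
  have h5 : ((l.length / q : ℕ) : ℝ) * |C| ≤ ε * l.length := by
    have h6 : |C| ≤ ε * q := by
      rw [div_le_iff₀ hε] at hp
      have : (q : ℝ) = p + 1 := by simp [hq]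
      rw [this]; nlinarith
    have h7 : ((l.length / q : ℕ) : ℝ) * q ≤ l.length := by
      exact_mod_cast Nat.div_mul_le_self _ _
    calc ((l.length / q : ℕ) : ℝ) * |C| ≤ ((l.length / q : ℕ) : ℝ) * (ε * q) := by gcongr
      _ = ε * (((l.length / q : ℕ) : ℝ) * q) := by ring
      _ ≤ ε * l.length := by gcongr
  have h8 : (n : ℝ) = ((l.length / q : ℕ) : ℝ) + b + 1 := by simp [hn]
  rw [h8]
  linarith

end WeightedWords


lemma exists_mem_forall_norm_eq_imp_eq {H : Type*} [NormedAddCommGroup H] [InnerProductSpace ℝ H]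
    [CompleteSpace H] {K : Set H} (hne : K.Nonempty) (hcl : IsClosed K) (hconv : Convex ℝ K) :
    ∃ v ∈ K, ∀ w ∈ K, ‖w‖ = ‖v‖ → w = v := by
  obtain ⟨v, hv, hmin⟩ := exists_norm_eq_iInf_of_complete_convex hne hcl.isComplete hconv 0
  refine ⟨v, hv, fun w hw hwv => ?_⟩
  have h := (norm_eq_iInf_iff_real_inner_le_zero hconv hv).mp hmin w hw
  rw [zero_sub, inner_neg_left, inner_sub_right, real_inner_self_eq_norm_sq] at h
  have h2 := norm_sub_sq_real v w
  rw [hwv] at h2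
  have h3 : ‖v - w‖ ^ 2 ≤ 0 := by linarith
  have h4 : ‖v - w‖ = 0 := by nlinarith [norm_nonneg (v - w)]
  exact (sub_eq_zero.mp (norm_eq_zero.mp h4)).symm

lemma exists_ae_eq_const_of_invariant {G X : Type*} [MeasurableSpace X] {μ : Measure X}
    [IsProbabilityMeasure μ] {T : G → X → X} {φ : X → ℝ}
    (hErg : ∀ A : Set X, MeasurableSet A →
      (∀ g : G, μ (symmDiff (T g ⁻¹' A) A) = 0) → μ A = 0 ∨ μ A = 1)
    (hφ : Measurable φ) (hinv : ∀ g, φ ∘ T g =ᵐ[μ] φ) : ∃ a : ℝ, φ =ᵐ[μ] fun _ => a := by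
  refine exists_eventuallyEq_const_of_forall_separating MeasurableSet fun U hU => ?_
  have hA := hφ hU
  have h0 : ∀ g, μ (symmDiff (T g ⁻¹' (φ ⁻¹' U)) (φ ⁻¹' U)) = 0 := fun g => by
    rw [measure_symmDiff_eq_zero_iff]
    filter_upwards [hinv g] with x hx
    have hx' : φ (T g x) = φ x := hx
    refine propext ?_
    change φ (T g x) ∈ U ↔ φ x ∈ U
    rw [hx']
  rcases hErg _ hA h0 with h | h
  · exact .inr (measure_eq_zero_iff_ae_notMem.mp h)
  · exact .inl ((prob_compl_eq_zero_iff hA).mpr h)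

section PathSum

open scoped ENNReal NNReal

variable {G : Type*} [Group G] {X : Type*}

/-- The sum of `φ` along the path `l` in the Cayley graph acting on `X` through `T`. -/
def pathSum (T : G → X → X) (φ : X → ℝ) : List G → X → ℝ
  | [], _ => 0
  | _ :: l, x => φ (T l.prod x) + pathSum T φ l x

lemma pathSum_linear (T : G → X → X) (φ ψ : X → ℝ) (a b : ℝ) (l : List G) (x : X) :
    pathSum T (fun y => a * φ y + b * ψ y) l x = a * pathSum T φ l x + b * pathSum T ψ l x := by
  induction l with
  | nil => simp [pathSum]
  | cons s l ih => simp only [pathSum, ih]; ring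

lemma pathSum_sub (T : G → X → X) (φ ψ : X → ℝ) (l : List G) (x : X) :
    pathSum T (fun y => φ y - ψ y) l x = pathSum T φ l x - pathSum T ψ l x := by
  induction l with
  | nil => simp [pathSum]
  | cons s l ih => simp only [pathSum, ih]; ring

lemma pathSum_const (T : G → X → X) (a : ℝ) (l : List G) (x : X) :
    pathSum T (fun _ => a) l x = l.length * a := by
  induction l with
  | nil => simp [pathSum]
  | cons s l ih => simp only [pathSum, ih, List.length_cons]; push_cast; ring

variable [MeasurableSpace X] {μ : Measure X} {T : G → X → X} {φ ψ : X → ℝ}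

lemma pathSum_congr (hT : ∀ g, MeasurePreserving (T g) μ μ) (h : φ =ᵐ[μ] ψ) (l : List G) :
    pathSum T φ l =ᵐ[μ] pathSum T ψ l := by
  induction l with
  | nil => rfl
  | cons s l ih =>
    filter_upwards [ih, (hT l.prod).quasiMeasurePreserving.ae_eq_comp h] with x h1 h2
    simp only [pathSum, h1]
    simpa using h2

lemma aemeasurable_pathSum (hT : ∀ g, MeasurePreserving (T g) μ μ) (h : AEMeasurable φ μ)
    (l : List G) : AEMeasurable (pathSum T φ l) μ := by
  induction l with
  | nil => exact aemeasurable_const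
  | cons s l ih => exact (h.comp_quasiMeasurePreserving (hT l.prod).quasiMeasurePreserving).add ih

lemma lintegral_comp_of_aemeasurable {g : X → X} (hg : MeasurePreserving g μ μ) {u : X → ℝ≥0∞}
    (hu : AEMeasurable u μ) : ∫⁻ x, u (g x) ∂μ = ∫⁻ x, u x ∂μ := by
  rw [← lintegral_map' (by rwa [hg.map_eq]) hg.aemeasurable, hg.map_eq]

lemma lintegral_pathSum_le (hT : ∀ g, MeasurePreserving (T g) μ μ) (h : AEMeasurable φ μ)
    (l : List G) :
    ∫⁻ x, ENNReal.ofReal (pathSum T φ l x) ∂μ ≤ l.length * ∫⁻ x, ENNReal.ofReal (φ x) ∂μ := by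
  induction l with
  | nil => simp [pathSum]
  | cons s l ih =>
    calc ∫⁻ x, ENNReal.ofReal (pathSum T φ (s :: l) x) ∂μ
        ≤ ∫⁻ x, ENNReal.ofReal (φ (T l.prod x)) + ENNReal.ofReal (pathSum T φ l x) ∂μ :=
          lintegral_mono fun x => ENNReal.ofReal_add_le
      _ = ∫⁻ x, ENNReal.ofReal (φ (T l.prod x)) ∂μ + ∫⁻ x, ENNReal.ofReal (pathSum T φ l x) ∂μ :=
          lintegral_add_right' _ (aemeasurable_pathSum hT h l).ennreal_ofReal
      _ ≤ ∫⁻ x, ENNReal.ofReal (φ x) ∂μ + l.length * ∫⁻ x, ENNReal.ofReal (φ x) ∂μ := by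
          exact add_le_add (lintegral_comp_of_aemeasurable (hT l.prod) h.ennreal_ofReal).le ih
      _ = _ := by push_cast [List.length_cons]; ring

lemma pathSum_comp (hT : ∀ g, MeasurePreserving (T g) μ μ)
    (hTmul : ∀ g h x, T (g * h) x = T g (T h x)) {k : G} (hk : ∀ h : G, φ ∘ T ⁅k, h⁆ =ᵐ[μ] φ)
    (l : List G) : pathSum T (φ ∘ T k) l =ᵐ[μ] pathSum T φ l ∘ T k := by
  induction l with
  | nil => rfl
  | cons s l ih =>
    filter_upwards [ih, (hT (l.prod * k)).quasiMeasurePreserving.ae_eq_comp (hk l.prod)]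
      with x h1 h2
    simp only [pathSum, h1, Function.comp_apply] at h2 ⊢
    rw [← hTmul, ← hTmul, ← h2, ← hTmul, commutatorElement_def]
    congr 3
    group

/-- The function `φ` majorizes `f` along paths, up to an error of mean `δ` per step. -/
def AlmostMajorant (S : Set G) (T : G → X → X) (μ : Measure X) (f : G → X → ℝ) (δ : ℝ≥0)
    (φ : X → ℝ) : Prop :=
  ∀ ε : ℝ≥0, 0 < ε → ∃ B : ℝ≥0, ∀ l : List G, (∀ s ∈ l, s ∈ S) →
    ∫⁻ x, ENNReal.ofReal (f l.prod x - pathSum T φ l x) ∂μ ≤ (δ + ε) * l.length + B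

namespace AlmostMajorant

variable {S : Set G} {f : G → X → ℝ} {δ : ℝ≥0}

lemma congr (hT : ∀ g, MeasurePreserving (T g) μ μ) (hφ : AlmostMajorant S T μ f δ φ)
    (h : φ =ᵐ[μ] ψ) : AlmostMajorant S T μ f δ ψ := by
  intro ε hε
  obtain ⟨B, hB⟩ := hφ ε hε
  refine ⟨B, fun l hl => (lintegral_congr_ae ?_).trans_le (hB l hl)⟩
  filter_upwards [pathSum_congr hT h l] with x hx
  rw [hx]

lemma convex (hT : ∀ g, MeasurePreserving (T g) μ μ) (hf : ∀ g, Measurable (f g))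
    (hφm : AEMeasurable φ μ)
    (hφ : AlmostMajorant S T μ f δ φ) (hψ : AlmostMajorant S T μ f δ ψ) {a b : ℝ} (ha : 0 ≤ a)
    (hb : 0 ≤ b) (hab : a + b = 1) :
    AlmostMajorant S T μ f δ (fun x => a * φ x + b * ψ x) := by
  intro ε hε
  obtain ⟨B, hB⟩ := hφ ε hε
  obtain ⟨D, hD⟩ := hψ ε hε
  refine ⟨B + D, fun l hl => ?_⟩
  have hab' : ENNReal.ofReal a + ENNReal.ofReal b = 1 := by
    rw [← ENNReal.ofReal_add ha hb, hab, ENNReal.ofReal_one]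
  have ha1 : ENNReal.ofReal a ≤ 1 := hab' ▸ le_self_add
  have hb1 : ENNReal.ofReal b ≤ 1 := hab' ▸ le_add_self
  calc ∫⁻ x, ENNReal.ofReal (f l.prod x - pathSum T (fun x => a * φ x + b * ψ x) l x) ∂μ
      ≤ ∫⁻ x, ENNReal.ofReal a * ENNReal.ofReal (f l.prod x - pathSum T φ l x) +
          ENNReal.ofReal b * ENNReal.ofReal (f l.prod x - pathSum T ψ l x) ∂μ := by
        refine lintegral_mono fun x => ?_
        dsimp only
        rw [← ENNReal.ofReal_mul ha, ← ENNReal.ofReal_mul hb, pathSum_linear]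
        refine le_trans (ENNReal.ofReal_le_ofReal (le_of_eq ?_)) ENNReal.ofReal_add_le
        linear_combination (-f l.prod x) * hab
    _ = ENNReal.ofReal a * ∫⁻ x, ENNReal.ofReal (f l.prod x - pathSum T φ l x) ∂μ +
          ENNReal.ofReal b * ∫⁻ x, ENNReal.ofReal (f l.prod x - pathSum T ψ l x) ∂μ := by
        rw [lintegral_add_left', lintegral_const_mul' _ _ ENNReal.ofReal_ne_top,
          lintegral_const_mul' _ _ ENNReal.ofReal_ne_top]
        exact ((hf _).aemeasurable.sub (aemeasurable_pathSum hT hφm l)).ennreal_ofReal.const_mul _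
    _ ≤ ENNReal.ofReal a * ((δ + ε) * l.length + B) +
          ENNReal.ofReal b * ((δ + ε) * l.length + D) := by
        gcongr
        · exact hB l hl
        · exact hD l hl
    _ = (ENNReal.ofReal a + ENNReal.ofReal b) * ((δ + ε) * l.length) +
          (ENNReal.ofReal a * B + ENNReal.ofReal b * D) := by ring
    _ ≤ 1 * ((δ + ε) * l.length) + (1 * B + 1 * D) := by rw [hab']; gcongr
    _ = (δ + ε) * l.length + ((B + D : ℝ≥0) : ℝ≥0∞) := by push_cast; ring

lemma of_forall_approx (hT : ∀ g, MeasurePreserving (T g) μ μ) (hψm : AEMeasurable ψ μ)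
    (h : ∀ η : ℝ≥0, 0 < η → ∃ φ, AEMeasurable φ μ ∧ AlmostMajorant S T μ f δ φ ∧
      ∫⁻ x, ENNReal.ofReal (φ x - ψ x) ∂μ ≤ η) : AlmostMajorant S T μ f δ ψ := by
  intro ε hε
  obtain ⟨φ, hφm, hφ, hφψ⟩ := h (ε / 2) (by positivity)
  obtain ⟨B, hB⟩ := hφ (ε / 2) (by positivity)
  refine ⟨B, fun l hl => ?_⟩
  have hm : AEMeasurable (fun x => φ x - ψ x) μ := hφm.sub hψm
  calc ∫⁻ x, ENNReal.ofReal (f l.prod x - pathSum T ψ l x) ∂μ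
      ≤ ∫⁻ x, ENNReal.ofReal (f l.prod x - pathSum T φ l x) +
          ENNReal.ofReal (pathSum T (fun x => φ x - ψ x) l x) ∂μ := by
        refine lintegral_mono fun x => ?_
        dsimp only
        refine le_trans (ENNReal.ofReal_le_ofReal (le_of_eq ?_)) ENNReal.ofReal_add_le
        rw [pathSum_sub]
        ring
    _ = ∫⁻ x, ENNReal.ofReal (f l.prod x - pathSum T φ l x) ∂μ +
          ∫⁻ x, ENNReal.ofReal (pathSum T (fun x => φ x - ψ x) l x) ∂μ :=
        lintegral_add_right' _ (aemeasurable_pathSum hT hm l).ennreal_ofReal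
    _ ≤ ((δ + (ε / 2 : ℝ≥0)) * l.length + B) + l.length * (ε / 2 : ℝ≥0) := by
        gcongr
        · exact hB l hl
        · exact (lintegral_pathSum_le hT hm l).trans (by gcongr)
    _ = (δ + ((ε / 2 + ε / 2 : ℝ≥0) : ℝ≥0∞)) * l.length + B := by push_cast; ring
    _ = (δ + ε) * l.length + B := by rw [add_halves]

end AlmostMajorant

lemma exists_lintegral_le_mul_length {S : Set G} (hSfin : S.Finite)
    (hT : ∀ g, MeasurePreserving (T g) μ μ) {f : G → X → ℝ} (hfmeas : ∀ g, Measurable (f g))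
    (hfsub : ∀ g h : G, ∀ᵐ x ∂μ, f (g * h) x ≤ f g (T h x) + f h x)
    (hfint : ∀ g, Integrable (f g) μ) :
    ∃ C : ℝ≥0, ∀ l : List G, (∀ s ∈ l, s ∈ S) →
      ∫⁻ x, ENNReal.ofReal (f l.prod x) ∂μ ≤ C * l.length + C := by
  have hfin : ∀ g, ∃ c : ℝ≥0, (c : ℝ≥0∞) = ∫⁻ x, ENNReal.ofReal (f g x) ∂μ := fun g =>
    ⟨_, ENNReal.coe_toNNReal (hfint g).lintegral_lt_top.ne⟩
  choose c hc using hfin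
  obtain ⟨C, hC⟩ := (hSfin.image c).bddAbove
  refine ⟨C + c 1, fun l hl => ?_⟩
  induction l with
  | nil => rw [List.prod_nil, ← hc]; simp
  | cons s l ih =>
    rw [List.forall_mem_cons] at hl
    rw [List.prod_cons]
    have hs : (c s : ℝ≥0∞) ≤ (C + c 1 : ℝ≥0) := by
      exact_mod_cast (hC ⟨s, hl.1, rfl⟩).trans le_self_add
    calc ∫⁻ x, ENNReal.ofReal (f (s * l.prod) x) ∂μ
        ≤ ∫⁻ x, ENNReal.ofReal (f s (T l.prod x)) + ENNReal.ofReal (f l.prod x) ∂μ := by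
          refine lintegral_mono_ae ?_
          filter_upwards [hfsub s l.prod] with x hx
          exact (ENNReal.ofReal_le_ofReal hx).trans ENNReal.ofReal_add_le
      _ = c s + ∫⁻ x, ENNReal.ofReal (f l.prod x) ∂μ := by
          rw [lintegral_add_right _ (hfmeas _).ennreal_ofReal,
            lintegral_comp_of_aemeasurable (hT _) (hfmeas s).ennreal_ofReal.aemeasurable, hc]
      _ ≤ (C + c 1 : ℝ≥0) + ((C + c 1 : ℝ≥0) * l.length + (C + c 1 : ℝ≥0)) := by
          gcongr
          exact ih hl.2
      _ = _ := by push_cast [List.length_cons]; ring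

lemma AlmostMajorant.comp {S : Set G} (hS : ∀ s ∈ S, s⁻¹ ∈ S) (hSfin : S.Finite)
    [Group.IsNilpotent G] (hT : ∀ g, MeasurePreserving (T g) μ μ)
    (hTmul : ∀ g h x, T (g * h) x = T g (T h x)) {f : G → X → ℝ} (hfmeas : ∀ g, Measurable (f g))
    (hfsub : ∀ g h : G, ∀ᵐ x ∂μ, f (g * h) x ≤ f g (T h x) + f h x)
    (hfint : ∀ g, Integrable (f g) μ) {δ : ℝ≥0} (hφm : AEMeasurable φ μ)
    (hφ : AlmostMajorant S T μ f δ φ) {k : List G} (hkS : ∀ s ∈ k, s ∈ S)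
    (hk : ∀ h : G, φ ∘ T ⁅k.prod, h⁆ =ᵐ[μ] φ) : AlmostMajorant S T μ f δ (φ ∘ T k.prod) := by
  intro ε hε
  obtain ⟨C, hC⟩ := exists_lintegral_le_mul_length hSfin hT hfmeas hfsub hfint
  obtain ⟨B, hB⟩ := hφ (ε / 2) (by positivity)
  have hη : (0 : ℝ) < ε / 2 / (C + 1) := by positivity
  have hkS' : ∀ s ∈ (k.map (·⁻¹)).reverse, s ∈ S := by
    intro s hs
    obtain ⟨t, ht, rfl⟩ := List.mem_map.mp (List.mem_reverse.mp hs)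
    exact hS _ (hkS _ ht)
  obtain ⟨D, hD⟩ := exists_list_prod_eq_conj hSfin hS hkS' hη
  have hD' : ∀ l : List G, (∀ s ∈ l, s ∈ S) →
      ∫⁻ x, ENNReal.ofReal (f (l.prod * k.prod⁻¹ * l.prod⁻¹) x) ∂μ ≤
        (ε / 2 : ℝ≥0) * l.length + (C * D.toNNReal + C : ℝ≥0) := by
    intro l hl
    obtain ⟨l', hl', hprod, hlen⟩ := hD l hl
    rw [← List.prod_inv_reverse] at hprod
    rw [← hprod]
    refine (hC l' hl').trans ?_
    have h1 : C * (l'.length : ℝ≥0) + C ≤ ε / 2 * l.length + (C * D.toNNReal + C) := by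
      rw [← NNReal.coe_le_coe]
      push_cast
      have h2 : (C : ℝ) * (ε / 2 / (C + 1)) ≤ ε / 2 := by
        rw [mul_div_assoc', div_le_iff₀ (by positivity)]
        nlinarith [C.2, ε.2]
      have h3 : (C : ℝ) * l'.length ≤ C * (ε / 2 / (C + 1) * l.length + max D 0) := by
        gcongr
        exact hlen.trans (by gcongr; exact le_max_left _ _)
      rw [Real.coe_toNNReal']
      nlinarith [mul_le_mul_of_nonneg_right h2 (Nat.cast_nonneg (α := ℝ) l.length)]
    exact_mod_cast h1
  obtain ⟨E, hE⟩ : ∃ E : ℝ≥0, (E : ℝ≥0∞) = ∫⁻ x, ENNReal.ofReal (f k.prod x) ∂μ :=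
    ⟨_, ENNReal.coe_toNNReal (hfint k.prod).lintegral_lt_top.ne⟩
  refine ⟨B + E + (C * D.toNNReal + C), fun l hl => ?_⟩
  have hm : AEMeasurable (fun x => ENNReal.ofReal (f l.prod x - pathSum T φ l x)) μ :=
    ((hfmeas l.prod).aemeasurable.sub (aemeasurable_pathSum hT hφm l)).ennreal_ofReal
  have hm' : Measurable fun x =>
      ENNReal.ofReal (f (l.prod * k.prod⁻¹ * l.prod⁻¹) (T (l.prod * k.prod) x)) :=
    ((hfmeas _).comp (hT _).measurable).ennreal_ofReal
  calc ∫⁻ x, ENNReal.ofReal (f l.prod x - pathSum T (φ ∘ T k.prod) l x) ∂μ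
      ≤ ∫⁻ x, (ENNReal.ofReal (f l.prod (T k.prod x) - pathSum T φ l (T k.prod x)) +
          ENNReal.ofReal (f k.prod x)) + ENNReal.ofReal
            (f (l.prod * k.prod⁻¹ * l.prod⁻¹) (T (l.prod * k.prod) x)) ∂μ := by
        refine lintegral_mono_ae ?_
        filter_upwards [pathSum_comp hT hTmul hk l, hfsub l.prod k.prod,
          hfsub (l.prod * k.prod⁻¹ * l.prod⁻¹) (l.prod * k.prod)] with x h1 h2 h3
        have e : l.prod * k.prod⁻¹ * l.prod⁻¹ * (l.prod * k.prod) = l.prod := by group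
        rw [e] at h3
        rw [h1, Function.comp_apply]
        refine le_trans (ENNReal.ofReal_le_ofReal ?_)
          (ENNReal.ofReal_add_le.trans (add_le_add_left ENNReal.ofReal_add_le _))
        linarith
    _ = ∫⁻ x, ENNReal.ofReal (f l.prod x - pathSum T φ l x) ∂μ + E +
          ∫⁻ x, ENNReal.ofReal (f (l.prod * k.prod⁻¹ * l.prod⁻¹) x) ∂μ := by
        rw [lintegral_add_right _ hm',
          lintegral_add_right _ (hfmeas _).ennreal_ofReal, hE,
          lintegral_comp_of_aemeasurable (hT _) hm,
          lintegral_comp_of_aemeasurable (hT _) (hfmeas _).ennreal_ofReal.aemeasurable]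
    _ ≤ ((δ + (ε / 2 : ℝ≥0)) * l.length + B) + E +
          ((ε / 2 : ℝ≥0) * l.length + (C * D.toNNReal + C : ℝ≥0)) := by
        gcongr
        · exact hB l hl
        · exact hD' l hl
    _ = (δ + ((ε / 2 + ε / 2 : ℝ≥0) : ℝ≥0∞)) * l.length +
          ((B + E + (C * D.toNNReal + C) : ℝ≥0) : ℝ≥0∞) := by push_cast; ring
    _ = _ := by rw [add_halves]

lemma exists_list_of_closure_eq_top {S : Set G} (hS : ∀ s ∈ S, s⁻¹ ∈ S)
    (hSgen : Subgroup.closure S = ⊤) (g : G) : ∃ l : List G, (∀ s ∈ l, s ∈ S) ∧ l.prod = g := by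
  have hg : g ∈ Subgroup.closure S := hSgen ▸ Subgroup.mem_top g
  rw [← Subgroup.mem_toSubmonoid, Subgroup.closure_toSubmonoid] at hg
  have hSS : S ∪ S⁻¹ = S := Set.union_eq_left.mpr fun s hs => by simpa using hS _ hs
  rw [hSS] at hg
  exact Submonoid.exists_list_of_mem_closure hg

lemma exists_length_eq_wlen {S : Set G} (hS : ∀ s ∈ S, s⁻¹ ∈ S)
    (hSgen : Subgroup.closure S = ⊤) (g : G) :
    ∃ l : List G, (∀ s ∈ l, s ∈ S) ∧ l.length = wlen S g ∧ l.prod = g := by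
  obtain ⟨l, hl, hg⟩ := exists_list_of_closure_eq_top hS hSgen g
  exact Nat.sInf_mem (s := {n : ℕ | ∃ l : List G, (∀ s ∈ l, s ∈ S) ∧ l.length = n ∧ l.prod = g})
    ⟨_, l, hl, rfl, hg⟩

lemma exists_simpleFunc_almostMajorant [IsProbabilityMeasure μ] {S : Set G} (hSfin : S.Finite)
    (hT : ∀ g, MeasurePreserving (T g) μ μ) {f : G → X → ℝ} (hfmeas : ∀ g, Measurable (f g))
    (hfpos : ∀ g x, 0 ≤ f g x)
    (hfsub : ∀ g h : G, ∀ᵐ x ∂μ, f (g * h) x ≤ f g (T h x) + f h x)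
    (hfint : ∀ g, Integrable (f g) μ) {δ : ℝ≥0} (hδ : 0 < δ) :
    ∃ φ : SimpleFunc X ℝ, AlmostMajorant S T μ f δ φ ∧
      ∫ x, φ x ∂μ ≤ ∑ s ∈ hSfin.toFinset, ∫ x, f s x ∂μ + δ := by
  set u : X → ℝ := fun x => ∑ s ∈ hSfin.toFinset, f s x with hu
  have hui : Integrable u μ := integrable_finsetSum _ fun s _ => hfint s
  obtain ⟨φ, hφ, hφL⟩ := (memLp_one_iff_integrable.mpr hui).exists_simpleFunc_eLpNorm_sub_lt
    ENNReal.one_ne_top (ε := δ) (by simpa using hδ.ne')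
  have hφi : Integrable φ μ := memLp_one_iff_integrable.mp hφL
  rw [eLpNorm_one_eq_lintegral_enorm] at hφ
  refine ⟨φ, fun ε hε => ?_, ?_⟩
  · obtain ⟨E, hE⟩ : ∃ E : ℝ≥0, (E : ℝ≥0∞) = ∫⁻ x, ENNReal.ofReal (f 1 x) ∂μ :=
      ⟨_, ENNReal.coe_toNNReal (hfint 1).lintegral_lt_top.ne⟩
    refine ⟨E, fun l hl => ?_⟩
    suffices h : ∫⁻ x, ENNReal.ofReal (f l.prod x - pathSum T φ l x) ∂μ ≤ δ * l.length + E from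
      h.trans (by gcongr; exact le_self_add)
    induction l with
    | nil => simp [pathSum, hE]
    | cons s l ih =>
      rw [List.forall_mem_cons] at hl
      have hm : Measurable fun x => ENNReal.ofReal (f s x - φ x) :=
        ((hfmeas s).sub φ.measurable).ennreal_ofReal
      have hle : ∫⁻ x, ENNReal.ofReal (f s x - φ x) ∂μ ≤ δ := by
        refine le_trans (lintegral_mono fun x => ?_) hφ.le
        have h1 : f s x ≤ u x := Finset.single_le_sum (f := fun s => f s x)
          (fun t _ => hfpos t x) (hSfin.mem_toFinset.mpr hl.1)
        rw [Real.enorm_eq_ofReal_abs]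
        refine ENNReal.ofReal_le_ofReal (le_trans ?_ (le_abs_self _))
        simpa using h1
      calc ∫⁻ x, ENNReal.ofReal (f (s :: l).prod x - pathSum T φ (s :: l) x) ∂μ
          ≤ ∫⁻ x, ENNReal.ofReal (f s (T l.prod x) - φ (T l.prod x)) +
              ENNReal.ofReal (f l.prod x - pathSum T φ l x) ∂μ := by
            refine lintegral_mono_ae ?_
            filter_upwards [hfsub s l.prod] with x hx
            refine le_trans (ENNReal.ofReal_le_ofReal ?_) ENNReal.ofReal_add_le
            rw [List.prod_cons, pathSum]
            linarith
        _ = ∫⁻ x, ENNReal.ofReal (f s x - φ x) ∂μ +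
              ∫⁻ x, ENNReal.ofReal (f l.prod x - pathSum T φ l x) ∂μ := by
            rw [lintegral_add_left (f := fun x => ENNReal.ofReal (f s (T l.prod x) - φ (T l.prod x)))
                (hm.comp (hT _).measurable), lintegral_comp_of_aemeasurable (hT _) hm.aemeasurable]
        _ ≤ δ + (δ * l.length + E) := add_le_add hle (ih hl.2)
        _ = δ * (s :: l).length + E := by push_cast [List.length_cons]; ring
  · have h1 : ∫ x, (φ x - u x) ∂μ ≤ δ := by
      refine (le_abs_self _).trans ?_
      rw [← Real.norm_eq_abs]
      refine (norm_integral_le_lintegral_norm _).trans ?_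
      refine ENNReal.toReal_le_of_le_ofReal δ.2 ?_
      rw [ENNReal.ofReal_coe_nnreal]
      refine le_trans (le_of_eq (lintegral_congr fun x => ?_)) hφ.le
      rw [ofReal_norm, Pi.sub_apply, ← enorm_neg, neg_sub]
    rw [integral_sub hφi hui, hu, integral_finsetSum _ fun s _ => hfint s] at h1
    linarith

lemma exists_invariant_almostMajorant [IsProbabilityMeasure μ] [Group.IsNilpotent G] {S : Set G}
    (hSfin : S.Finite) (hS : ∀ s ∈ S, s⁻¹ ∈ S) (hSgen : Subgroup.closure S = ⊤)
    (hT1 : ∀ x, T 1 x = x) (hTmul : ∀ g h x, T (g * h) x = T g (T h x))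
    (hT : ∀ g, MeasurePreserving (T g) μ μ) {f : G → X → ℝ} (hfmeas : ∀ g, Measurable (f g))
    (hfsub : ∀ g h : G, ∀ᵐ x ∂μ, f (g * h) x ≤ f g (T h x) + f h x)
    (hfint : ∀ g, Integrable (f g) μ) {δ : ℝ≥0} {c : ℝ} {φ : Lp ℝ 2 μ}
    (hφ : AlmostMajorant S T μ f δ φ) (hc : ∫ x, φ x ∂μ ≤ c) :
    ∃ ψ : Lp ℝ 2 μ, AlmostMajorant S T μ f δ ψ ∧ (∀ g, ψ ∘ T g =ᵐ[μ] ψ) ∧ ∫ x, ψ x ∂μ ≤ c := by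
  suffices H : ∀ n, ∃ ψ : Lp ℝ 2 μ, AlmostMajorant S T μ f δ ψ ∧
      (∀ g ∈ Subgroup.upperCentralSeries G n, ψ ∘ T g =ᵐ[μ] ψ) ∧ ∫ x, ψ x ∂μ ≤ c by
    obtain ⟨n, hn⟩ := ‹Group.IsNilpotent G›.nilpotent
    obtain ⟨ψ, h1, h2, h3⟩ := H n
    exact ⟨ψ, h1, fun g => h2 g (hn ▸ Subgroup.mem_top g), h3⟩
  have haem : ∀ ψ : Lp ℝ 2 μ, AEMeasurable ψ μ := fun ψ => (Lp.stronglyMeasurable ψ).aemeasurable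
  have integrable_Lp : ∀ ψ : Lp ℝ 2 μ, Integrable ψ μ := fun ψ => (Lp.memLp ψ).integrable one_le_two
  let U : G → Lp ℝ 2 μ → Lp ℝ 2 μ := fun g => Lp.compMeasurePreserving (T g) (hT g)
  have hU : ∀ g (ψ : Lp ℝ 2 μ), U g ψ =ᵐ[μ] ψ ∘ T g := fun g ψ =>
    Lp.coeFn_compMeasurePreserving ψ (hT g)
  have hUinv : ∀ g (ψ : Lp ℝ 2 μ), U g ψ = ψ ↔ ψ ∘ T g =ᵐ[μ] ψ := fun g ψ =>
    ⟨fun h => (hU g ψ).symm.trans (by rw [h]), fun h => Lp.ext ((hU g ψ).trans h)⟩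
  have hUcont : ∀ g, Continuous (U g) := fun g => (Lp.isometry_compMeasurePreserving _).continuous
  intro n
  induction n with
  | zero =>
    refine ⟨φ, hφ, fun g hg => ?_, hc⟩
    rw [Subgroup.upperCentralSeries_zero, Subgroup.mem_bot] at hg
    exact .of_forall fun x => by rw [hg, Function.comp_apply, hT1]
  | succ n ih =>
    set K : Set (Lp ℝ 2 μ) := {ψ | AlmostMajorant S T μ f δ ψ ∧
      (∀ g ∈ Subgroup.upperCentralSeries G n, ψ ∘ T g =ᵐ[μ] ψ) ∧ ∫ x, ψ x ∂μ ≤ c} with hK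
    have hcl : IsClosed K := by
      have hK' : K = {ψ : Lp ℝ 2 μ | AlmostMajorant S T μ f δ ψ} ∩
          ((⋂ g ∈ Subgroup.upperCentralSeries G n, {ψ | U g ψ = ψ}) ∩
            {ψ : Lp ℝ 2 μ | ∫ x, ψ x ∂μ ≤ c}) := by
        ext ψ
        simp [hK, hUinv]
      rw [hK']
      refine IsClosed.inter ?_ (IsClosed.inter ?_ ?_)
      · refine isClosed_of_closure_subset fun ψ hψ => ?_
        refine AlmostMajorant.of_forall_approx hT (haem ψ) fun η hη => ?_
        obtain ⟨χ, hχ, hd⟩ := Metric.mem_closure_iff.mp hψ η hη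
        refine ⟨χ, haem χ, hχ, ?_⟩
        calc ∫⁻ x, ENNReal.ofReal (χ x - ψ x) ∂μ ≤ ∫⁻ x, ‖(χ - ψ : Lp ℝ 2 μ) x‖ₑ ∂μ := by
              refine lintegral_mono_ae ?_
              filter_upwards [Lp.coeFn_sub χ ψ] with x hx
              rw [hx, Real.enorm_eq_ofReal_abs]
              exact ENNReal.ofReal_le_ofReal (le_abs_self _)
          _ = eLpNorm (χ - ψ : Lp ℝ 2 μ) 1 μ := eLpNorm_one_eq_lintegral_enorm.symm
          _ ≤ eLpNorm (χ - ψ : Lp ℝ 2 μ) 2 μ :=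
              eLpNorm_le_eLpNorm_of_exponent_le one_le_two (Lp.aestronglyMeasurable _)
          _ = ‖χ - ψ‖ₑ := (Lp.enorm_def _).symm
          _ ≤ η := by
              rw [← ofReal_norm, ← ENNReal.ofReal_coe_nnreal]
              refine ENNReal.ofReal_le_ofReal ?_
              rw [← dist_eq_norm, dist_comm]
              exact hd.le
      · exact isClosed_biInter fun g _ => isClosed_eq (hUcont g) continuous_id
      · have h : ∀ ψ : Lp ℝ 2 μ, ∫ x, ψ x ∂μ =
            inner ℝ (indicatorConstLp 2 MeasurableSet.univ (measure_ne_top μ _) (1 : ℝ)) ψ := by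
          intro ψ
          rw [L2.inner_indicatorConstLp_one, setIntegral_univ]
        simp only [h]
        exact isClosed_le (continuous_const.inner continuous_id) continuous_const
    have hconv : Convex ℝ K := by
      rintro ψ ⟨h1, h2, h3⟩ χ ⟨k1, k2, k3⟩ a b ha hb hab
      have hcoe : (a • ψ + b • χ : Lp ℝ 2 μ) =ᵐ[μ] fun x => a * ψ x + b * χ x := by
        filter_upwards [Lp.coeFn_add (a • ψ) (b • χ), Lp.coeFn_smul a ψ, Lp.coeFn_smul b χ]
          with x e1 e2 e3
        rw [e1, Pi.add_apply, e2, e3, Pi.smul_apply, Pi.smul_apply, smul_eq_mul, smul_eq_mul]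
      refine ⟨(h1.convex hT hfmeas (haem ψ) k1 ha hb hab).congr hT hcoe.symm, fun g hg => ?_, ?_⟩
      · filter_upwards [(hT g).quasiMeasurePreserving.ae_eq_comp hcoe, hcoe, h2 g hg, k2 g hg]
          with x e1 e2 e3 e4
        simp only [Function.comp_apply] at e1 e3 e4 ⊢
        rw [e1, e2, e3, e4]
      · rw [integral_congr_ae hcoe, integral_add ((integrable_Lp ψ).const_mul a) ((integrable_Lp χ).const_mul b),
          integral_const_mul, integral_const_mul]
        calc _ ≤ a * c + b * c := by gcongr
          _ = c := by rw [← add_mul, hab, one_mul]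
    obtain ⟨ψ, hψK, hψ⟩ := exists_mem_forall_norm_eq_imp_eq ih hcl hconv
    refine ⟨ψ, hψK.1, fun g hg => ?_, hψK.2.2⟩
    rw [← hUinv]
    refine hψ _ ⟨?_, fun z hz => ?_, ?_⟩ (Lp.norm_compMeasurePreserving _ _)
    · obtain ⟨k, hk, rfl⟩ := exists_list_of_closure_eq_top hS hSgen g
      exact (hψK.1.comp hS hSfin hT hTmul hfmeas hfsub hfint (haem ψ) hk fun h =>
        hψK.2.1 _ (Subgroup.mem_upperCentralSeries_succ_iff.mp hg h)).congr hT (hU _ ψ).symm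
    · have hz' : g * z * g⁻¹ ∈ Subgroup.upperCentralSeries G n := Subgroup.Normal.conj_mem
        inferInstance z hz g
      filter_upwards [(hT z).quasiMeasurePreserving.ae_eq_comp (hU g ψ), hU g ψ,
        (hT g).quasiMeasurePreserving.ae_eq_comp (hψK.2.1 _ hz')] with x e1 e2 e3
      simp only [Function.comp_apply] at e1 e2 e3 ⊢
      rw [e1, e2, ← e3, ← hTmul, ← hTmul]
      congr 2
      group
    · have h : ∫ x, U g ψ x ∂μ = ∫ x, ψ x ∂μ := by
        rw [integral_congr_ae (hU g ψ)]
        have := integral_map (hT g).aemeasurable (f := ψ)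
          (by rw [(hT g).map_eq]; exact Lp.aestronglyMeasurable ψ)
        rw [(hT g).map_eq] at this
        exact this.symm
      exact h.trans_le hψK.2.2

end PathSum
theorem stmt0 {G : Type*} [Group G] [Group.IsNilpotent G]
    (S : Set G) (hSfin : S.Finite) (hSsymm : ∀ s ∈ S, s⁻¹ ∈ S)
    (hSgen : Subgroup.closure S = ⊤)
    {X : Type*} [MeasurableSpace X] (μ : Measure X) [IsProbabilityMeasure μ]
    (T : G → X → X) (hTmeas : ∀ g, Measurable (T g))
    (hT1 : ∀ x, T 1 x = x) (hTmul : ∀ g h x, T (g * h) x = T g (T h x))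
    (hTpres : ∀ g, MeasurePreserving (T g) μ μ)
    (hErg : ∀ A : Set X, MeasurableSet A →
      (∀ g : G, μ (symmDiff (T g ⁻¹' A) A) = 0) → μ A = 0 ∨ μ A = 1)
    (f : G → X → ℝ) (hfmeas : ∀ g, Measurable (f g)) (hfpos : ∀ g x, 0 ≤ f g x)
    (hfsub : ∀ g h : G, ∀ᵐ x ∂μ, f (g * h) x ≤ f g (T h x) + f h x)
    (hfint : ∀ g, Integrable (f g) μ) :
    ∃ M : ℝ, 1 ≤ M ∧ ∀ ε : ℝ, 0 < ε → ∃ N : ℕ, ∀ g : G, N ≤ wlen S g →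
      μ {x | M * (wlen S g : ℝ) ≤ f g x} < ENNReal.ofReal ε := by
  set c : ℝ := ∑ s ∈ hSfin.toFinset, ∫ x, f s x ∂μ + 1 with hc
  have hc0 : 0 ≤ c := add_nonneg
    (Finset.sum_nonneg fun s _ => integral_nonneg (hfpos s)) zero_le_one
  refine ⟨c + 1, by linarith, fun ε hε => ?_⟩
  lift ε to NNReal using hε.le
  rw [NNReal.coe_pos] at hε
  have hδ : 0 < min (ε / 4) 1 := lt_min (by positivity) one_pos
  obtain ⟨φ, hφ, hφc⟩ :=
    exists_simpleFunc_almostMajorant hSfin hTpres hfmeas hfpos hfsub hfint hδ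
  have hφL : MemLp φ 2 μ := φ.memLp_of_isFiniteMeasure 2 μ
  have hφc' : ∫ x, hφL.toLp φ x ∂μ ≤ c := by
    rw [integral_congr_ae hφL.coeFn_toLp]
    refine hφc.trans ?_
    have : ((min (ε / 4) 1 : NNReal) : ℝ) ≤ 1 := by exact_mod_cast min_le_right _ _
    linarith
  obtain ⟨ψ, hψ, hψinv, hψc⟩ := exists_invariant_almostMajorant hSfin hSsymm hSgen hT1 hTmul hTpres
    hfmeas hfsub hfint (hφ.congr hTpres hφL.coeFn_toLp.symm) hφc'
  have hψm := (Lp.stronglyMeasurable ψ).measurable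
  obtain ⟨a, ha⟩ := exists_ae_eq_const_of_invariant hErg hψm hψinv
  have hac : a ≤ c := by
    rw [integral_congr_ae ha] at hψc
    simpa using hψc
  obtain ⟨B, hB⟩ := hψ (ε / 4) (by positivity)
  obtain ⟨N, hN⟩ := exists_nat_gt (B / (ε / 2))
  refine ⟨N, fun g hg => ?_⟩
  obtain ⟨l, hl, hlen, hprod⟩ := exists_length_eq_wlen hSsymm hSgen g
  rw [← hlen] at hg ⊢
  have hBN : B < ε / 2 * l.length := by
    rw [div_lt_iff₀ (by positivity)] at hN
    rw [mul_comm]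
    exact hN.trans_le (by gcongr)
  have hmono : μ {x | (c + 1) * (l.length : ℝ) ≤ f g x} ≤
      μ {x | (l.length : ENNReal) ≤ ENNReal.ofReal (f l.prod x - pathSum T ψ l x)} := by
    refine measure_mono_ae ?_
    filter_upwards [pathSum_congr hTpres ha l] with x hx hfx
    have hfx' : (c + 1) * (l.length : ℝ) ≤ f g x := hfx
    change (l.length : ENNReal) ≤ ENNReal.ofReal (f l.prod x - pathSum T ψ l x)
    rw [hx, pathSum_const, hprod, ← ENNReal.ofReal_natCast]
    refine ENNReal.ofReal_le_ofReal ?_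
    nlinarith [mul_le_mul_of_nonneg_left hac (Nat.cast_nonneg (α := ℝ) l.length)]
  have hmeas : AEMeasurable (fun x => ENNReal.ofReal (f l.prod x - pathSum T ψ l x)) μ :=
    ((hfmeas _).aemeasurable.sub
      (aemeasurable_pathSum hTpres hψm.aemeasurable l)).ennreal_ofReal
  have hmarkov := (mul_meas_ge_le_lintegral₀ hmeas (l.length : ENNReal)).trans (hB l hl)
  by_contra! hcon
  rw [ENNReal.ofReal_coe_nnreal] at hcon
  have h1 : (l.length : ENNReal) * ε ≤
      ((min (ε / 4) 1 : NNReal) + (ε / 4 : NNReal)) * l.length + B :=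
    (mul_le_mul_right (hcon.trans hmono) _).trans hmarkov
  have h2 : (l.length : NNReal) * ε ≤ (min (ε / 4) 1 + ε / 4) * l.length + B := by
    exact_mod_cast h1
  have h3 : (min (ε / 4) 1 + ε / 4) * (l.length : NNReal) ≤ (ε / 4 + ε / 4) * l.length := by
    gcongr
    exact min_le_left _ _
  have h4 : (l.length : NNReal) * ε < (ε / 4 + ε / 4) * l.length + ε / 2 * l.length :=
    (h2.trans (add_le_add_left h3 _)).trans_lt (add_lt_add_right hBN _)
  rw [← NNReal.coe_lt_coe] at h4
  push_cast at h4
  linarith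
end

section
/- Let G and H be finitely generated nilpotent groups with finite symmetric generating sets, word lengths |·|_G, |·|_H and right-invariant word metrics d_G, d_H. Let (X,μ,T) be an ergodic probability G-space, let α : G × X → H be an integrable cocycle over T, and let M ≥ 1 be a constant such that μ{x : |α(g,x)|_H ≥ M·|g|_G} → 0 as |g|_G → ∞. Then for every ε > 0 and every N ∈ ℕ there exists C = C(ε,N) > 0 such that: whenever F ⊆ G is a set with |F| = N which is C-separated for d_G (i.e. d_G(g,g') ≥ C for all distinct g,g' ∈ F), one has μ{x ∈ X : d_H(α_x(g),α_x(g')) ≤ 2M·d_G(g,g') for all g,g' ∈ F} > 1 − ε, where α_x(g) := α(g,x). -/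
open MeasureTheory Filter

/-- The identity has word length zero. -/
theorem wlen_one {G : Type*} [Group G] (S : Set G) : wlen S (1 : G) = 0 :=
  Nat.sInf_eq_zero.mpr (Or.inl ⟨[], by simp, rfl, rfl⟩)

/-- By the cocycle identity and invariance of the measure, the displacement of `α` between `g'` and
`g` is distributed like `α (g * g'⁻¹)`. -/
theorem measure_cocycle_displacement_le {G H X : Type*} [Group G] [Group H] [MeasurableSpace X]
    {μ : Measure X} {T : G → X → X} (hTpres : ∀ g, MeasurePreserving (T g) μ μ)
    {α : G → X → H}
    (hαcoc : ∀ g₁ g₂ : G, ∀ᵐ x ∂μ, α (g₁ * g₂) x = α g₁ (T g₂ x) * α g₂ x)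
    (p : H → Prop) (g g' : G) :
    μ {x | p (α g x * (α g' x)⁻¹)} ≤ μ {x | p (α (g * g'⁻¹) x)} := by
  calc μ {x | p (α g x * (α g' x)⁻¹)}
      ≤ μ (T g' ⁻¹' {x | p (α (g * g'⁻¹) x)}) := by
        refine measure_mono_ae ?_
        filter_upwards [hαcoc (g * g'⁻¹) g'] with x hx hp
        rw [inv_mul_cancel_right] at hx
        change p (α g x * (α g' x)⁻¹) at hp
        change p (α (g * g'⁻¹) (T g' x))
        rwa [hx, mul_inv_cancel_right] at hp
    _ ≤ (μ.map (T g')) {x | p (α (g * g'⁻¹) x)} :=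
        Measure.le_map_apply (hTpres g').measurable.aemeasurable _
    _ = μ {x | p (α (g * g'⁻¹) x)} := by rw [(hTpres g').map_eq]

theorem stmt1 {G H : Type*} [Group G] [Group.IsNilpotent G]
    [Group H] [Group.IsNilpotent H]
    (SG : Set G) (hSGfin : SG.Finite) (hSGsymm : ∀ s ∈ SG, s⁻¹ ∈ SG)
    (hSGgen : Subgroup.closure SG = ⊤)
    (SH : Set H) (hSHfin : SH.Finite) (hSHsymm : ∀ s ∈ SH, s⁻¹ ∈ SH)
    (hSHgen : Subgroup.closure SH = ⊤)
    {X : Type*} [MeasurableSpace X] (μ : Measure X) [IsProbabilityMeasure μ]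
    (T : G → X → X) (hTmeas : ∀ g, Measurable (T g))
    (hT1 : ∀ x, T 1 x = x) (hTmul : ∀ g h x, T (g * h) x = T g (T h x))
    (hTpres : ∀ g, MeasurePreserving (T g) μ μ)
    (hErg : ∀ A : Set X, MeasurableSet A →
      (∀ g : G, μ (symmDiff (T g ⁻¹' A) A) = 0) → μ A = 0 ∨ μ A = 1)
    (α : G → X → H) (hαmeas : ∀ (g : G) (h : H), MeasurableSet {x | α g x = h})
    (hαcoc : ∀ g₁ g₂ : G, ∀ᵐ x ∂μ, α (g₁ * g₂) x = α g₁ (T g₂ x) * α g₂ x)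
    (hαint : ∀ g : G, Integrable (fun x => (wlen SH (α g x) : ℝ)) μ)
    (M : ℝ) (hM : 1 ≤ M)
    (hMconv : ∀ ε : ℝ, 0 < ε → ∃ N : ℕ, ∀ g : G, N ≤ wlen SG g →
      μ {x | M * (wlen SG g : ℝ) ≤ (wlen SH (α g x) : ℝ)} < ENNReal.ofReal ε) :
    ∀ ε : ℝ, 0 < ε → ∀ N : ℕ, ∃ C : ℝ, 0 < C ∧
      ∀ F : Finset G, F.card = N →
        (∀ g ∈ F, ∀ g' ∈ F, g ≠ g' → C ≤ (wlen SG (g * g'⁻¹) : ℝ)) →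
        ENNReal.ofReal (1 - ε) < μ {x | ∀ g ∈ F, ∀ g' ∈ F,
          (wlen SH (α g x * (α g' x)⁻¹) : ℝ) ≤ 2 * M * (wlen SG (g * g'⁻¹) : ℝ)} := by
  classical
  intro ε hε N
  set δ : ℝ := min ε 1 / ((N : ℝ) * N + 1) with hδ_def
  have hε' : 0 < min ε 1 := lt_min hε one_pos
  have hδ : 0 < δ := by positivity
  have hNδ : (N : ℝ) * N * δ < min ε 1 := by
    have : δ * ((N : ℝ) * N + 1) = min ε 1 := by
      rw [hδ_def]; field_simp
    linarith
  obtain ⟨K, hK⟩ := hMconv δ hδ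
  refine ⟨K + 1, by positivity, fun F hF hsep => ?_⟩
  set good : Set X := {x | ∀ g ∈ F, ∀ g' ∈ F,
    (wlen SH (α g x * (α g' x)⁻¹) : ℝ) ≤ 2 * M * (wlen SG (g * g'⁻¹) : ℝ)}
  let bad : G × G → Set X := fun q =>
    {x | M * (wlen SG (q.1 * q.2⁻¹) : ℝ) ≤ (wlen SH (α q.1 x * (α q.2 x)⁻¹) : ℝ)}
  have hbad : ∀ q ∈ F.offDiag, μ.real (bad q) ≤ δ := by
    intro q hq
    obtain ⟨h₁, h₂, hne⟩ := Finset.mem_offDiag.mp hq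
    have hle : K ≤ wlen SG (q.1 * q.2⁻¹) := by
      have := hsep _ h₁ _ h₂ hne
      exact_mod_cast (le_add_of_nonneg_right zero_le_one).trans this
    exact ENNReal.toReal_le_of_le_ofReal hδ.le
      ((measure_cocycle_displacement_le hTpres hαcoc
        (fun h => M * (wlen SG (q.1 * q.2⁻¹) : ℝ) ≤ (wlen SH h : ℝ)) q.1 q.2).trans (hK _ hle).le)
  have hcover : Set.univ ⊆ good ∪ ⋃ q ∈ F.offDiag, bad q := by
    intro x _
    by_contra hx
    simp only [Set.mem_union, Set.mem_iUnion, not_or, not_exists] at hx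
    refine hx.1 fun g hg g' hg' => ?_
    rcases eq_or_ne g g' with rfl | hne
    · simp [wlen_one]
    · have hlt : (wlen SH (α g x * (α g' x)⁻¹) : ℝ) < M * (wlen SG (g * g'⁻¹) : ℝ) :=
        lt_of_not_ge (hx.2 (g, g') (Finset.mem_offDiag.mpr ⟨hg, hg', hne⟩))
      have hnonneg : 0 ≤ M * (wlen SG (g * g'⁻¹) : ℝ) := by positivity
      linarith
  have hunion : μ.real (⋃ q ∈ F.offDiag, bad q) ≤ (N : ℝ) * N * δ := by
    calc μ.real (⋃ q ∈ F.offDiag, bad q) ≤ ∑ q ∈ F.offDiag, μ.real (bad q) :=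
          measureReal_biUnion_finset_le _ _
      _ ≤ F.offDiag.card • δ := Finset.sum_le_card_nsmul _ _ _ hbad
      _ ≤ (N : ℝ) * N * δ := by
          rw [nsmul_eq_mul]
          gcongr
          rw [Finset.offDiag_card, hF]
          exact_mod_cast Nat.sub_le _ _
  have hone : 1 ≤ μ.real good + μ.real (⋃ q ∈ F.offDiag, bad q) :=
    calc (1 : ℝ) = μ.real Set.univ := probReal_univ.symm
      _ ≤ μ.real (good ∪ ⋃ q ∈ F.offDiag, bad q) := measureReal_mono hcover
      _ ≤ _ := measureReal_union_le _ _
  have hmin₁ := min_le_left ε 1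
  have hmin₂ := min_le_right ε 1
  rw [← ofReal_measureReal (μ := μ) (s := good), ENNReal.ofReal_lt_ofReal_iff (by linarith)]
  linarith
end

section
/- Let G be a finitely generated nilpotent group with finite symmetric generating set and word length |·|_G, let (X,μ,T) be an ergodic probability G-space, let f : G × X → [0,∞) be an integrable sub-cocycle, and let M ≥ 1 be a constant such that μ{x : f(g,x) ≥ M·|g|_G} → 0 as |g|_G → ∞. Then for every ε > 0 there exists R = R(ε) > 0 such that μ{x ∈ X : f(g,x) ≥ M·|g|_G + R} < ε for every g ∈ G. -/
open MeasureTheory Filter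

theorem exists_list_length_eq_wlen {G : Type*} [Group G] {S : Set G}
    (hSsymm : ∀ s ∈ S, s⁻¹ ∈ S) (hSgen : Subgroup.closure S = ⊤) (g : G) :
    ∃ l : List G, (∀ s ∈ l, s ∈ S) ∧ l.length = wlen S g ∧ l.prod = g := by
  have hg : g ∈ (Subgroup.closure S).toSubmonoid := by simp [hSgen]
  rw [Subgroup.closure_toSubmonoid] at hg
  obtain ⟨l, hl, hprod⟩ := Submonoid.exists_list_of_mem_closure hg
  have hlS : ∀ s ∈ l, s ∈ S := fun s hs =>
    (hl s hs).elim id fun h => inv_inv s ▸ hSsymm _ h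
  exact Nat.sInf_mem
    (s := {n : ℕ | ∃ l : List G, (∀ s ∈ l, s ∈ S) ∧ l.length = n ∧ l.prod = g})
    ⟨l.length, l, hlS, rfl, hprod⟩

theorem finite_setOf_wlen_lt {G : Type*} [Group G] {S : Set G} (hSfin : S.Finite)
    (hSsymm : ∀ s ∈ S, s⁻¹ ∈ S) (hSgen : Subgroup.closure S = ⊤) (N : ℕ) :
    {g : G | wlen S g < N}.Finite := by
  have := hSfin.to_subtype
  refine ((List.finite_length_lt S N).image fun l => (l.map Subtype.val).prod).subset ?_
  intro g hg
  obtain ⟨l, hl, hlen, hprod⟩ := exists_list_length_eq_wlen hSsymm hSgen g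
  lift l to List S using hl
  refine ⟨l, ?_, hprod⟩
  rw [List.length_map] at hlen
  exact hlen.trans_lt hg

theorem measure_le_lt_ofReal_of_integral_lt {X : Type*} [MeasurableSpace X] {μ : Measure X}
    [IsFiniteMeasure μ] {f : X → ℝ} (hf : Integrable f μ) (hf0 : ∀ x, 0 ≤ f x)
    {R ε : ℝ} (hR : 0 < R) (h : ∫ x, f x ∂μ < R * ε) :
    μ {x | R ≤ f x} < ENNReal.ofReal ε := by
  have hmarkov := mul_meas_ge_le_integral_of_nonneg (Eventually.of_forall hf0) hf R
  exact (ENNReal.lt_ofReal_iff_toReal_lt (measure_ne_top μ _)).2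
    (lt_of_mul_lt_mul_left (hmarkov.trans_lt h) hR.le)

theorem stmt2 {G : Type*} [Group G] [Group.IsNilpotent G]
    (S : Set G) (hSfin : S.Finite) (hSsymm : ∀ s ∈ S, s⁻¹ ∈ S)
    (hSgen : Subgroup.closure S = ⊤)
    {X : Type*} [MeasurableSpace X] (μ : Measure X) [IsProbabilityMeasure μ]
    (T : G → X → X) (hTmeas : ∀ g, Measurable (T g))
    (hT1 : ∀ x, T 1 x = x) (hTmul : ∀ g h x, T (g * h) x = T g (T h x))
    (hTpres : ∀ g, MeasurePreserving (T g) μ μ)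
    (hErg : ∀ A : Set X, MeasurableSet A →
      (∀ g : G, μ (symmDiff (T g ⁻¹' A) A) = 0) → μ A = 0 ∨ μ A = 1)
    (f : G → X → ℝ) (hfmeas : ∀ g, Measurable (f g)) (hfpos : ∀ g x, 0 ≤ f g x)
    (hfsub : ∀ g h : G, ∀ᵐ x ∂μ, f (g * h) x ≤ f g (T h x) + f h x)
    (hfint : ∀ g, Integrable (f g) μ)
    (M : ℝ) (hM : 1 ≤ M)
    (hMconv : ∀ ε : ℝ, 0 < ε → ∃ N : ℕ, ∀ g : G, N ≤ wlen S g →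
      μ {x | M * (wlen S g : ℝ) ≤ f g x} < ENNReal.ofReal ε) :
    ∀ ε : ℝ, 0 < ε → ∃ R : ℝ, 0 < R ∧ ∀ g : G,
      μ {x | M * (wlen S g : ℝ) + R ≤ f g x} < ENNReal.ofReal ε := by
  intro ε hε
  obtain ⟨N, hN⟩ := hMconv ε hε
  obtain ⟨C, hC⟩ := ((finite_setOf_wlen_lt hSfin hSsymm hSgen N).image
    fun g => ∫ x, f g x ∂μ).bddAbove
  have hR : 0 < |C| / ε + 1 := by positivity
  refine ⟨|C| / ε + 1, hR, fun g => ?_⟩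
  rcases le_or_gt N (wlen S g) with h | h
  · exact (measure_mono fun x hx => (le_add_of_nonneg_right hR.le).trans hx).trans_lt (hN g h)
  · have hgC : ∫ x, f g x ∂μ ≤ C := hC ⟨g, h, rfl⟩
    have hlt : ∫ x, f g x ∂μ < (|C| / ε + 1) * ε := by
      rw [add_mul, div_mul_cancel₀ _ hε.ne', one_mul]
      linarith [le_abs_self C]
    have hMg : 0 ≤ M * (wlen S g : ℝ) := by positivity
    exact (measure_mono fun x hx => (le_add_of_nonneg_left hMg).trans hx).trans_lt
      (measure_le_lt_ofReal_of_integral_lt (hfint g) (hfpos g) hR hlt)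
end

section
/- Let G be a finitely generated nilpotent group, let (X,μ,T) be an ergodic probability G-space, and let f : G × X → [0,∞) be an integrable sub-cocycle. Then for every g ∈ G there is a constant c with c ≤ ∫_X f(g,x) dμ(x) such that (1/n)·f(gⁿ,x) → c as n → ∞ for μ-a.e. x ∈ X. -/
open MeasureTheory Filter

section CommutatorCalculus

open scoped commutatorElement

variable {H : Type*} [Group H]

theorem commutatorElement_mul_right_of_mem_center {x q : H} (p : H)
    (h : ⁅x, q⁆ ∈ Subgroup.center H) : ⁅x, p * q⁆ = ⁅x, p⁆ * ⁅x, q⁆ := by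
  have h' := Subgroup.mem_center_iff.1 h p⁻¹
  have : ⁅x, p * q⁆ = x * p * x⁻¹ * (⁅x, q⁆ * p⁻¹) := by
    simp only [commutatorElement_def]; group
  rw [this, ← h']
  simp only [commutatorElement_def]; group

theorem commutatorElement_mul_left_of_mem_center {x p : H} (y : H)
    (h : ⁅x, p⁆ ∈ Subgroup.center H) : ⁅y * x, p⁆ = ⁅y, p⁆ * ⁅x, p⁆ := by
  have h' := Subgroup.mem_center_iff.1 h y
  have : ⁅y * x, p⁆ = (y * ⁅x, p⁆) * p * y⁻¹ * p⁻¹ := by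
    simp only [commutatorElement_def]; group
  have h2 := Subgroup.mem_center_iff.1 h (y * p * y⁻¹ * p⁻¹)
  rw [this, h', commutatorElement_def y p, h2]
  group

theorem commutatorElement_pow_right_of_mem_center {x p : H}
    (h : ⁅x, p⁆ ∈ Subgroup.center H) (m : ℕ) : ⁅x, p ^ m⁆ = ⁅x, p⁆ ^ m := by
  induction m with
  | zero => simp
  | succ m ih => rw [pow_succ, commutatorElement_mul_right_of_mem_center _ h, ih, pow_succ]

theorem commutatorElement_pow_left_of_mem_center {x p : H}
    (h : ⁅x, p⁆ ∈ Subgroup.center H) (m : ℕ) : ⁅x ^ m, p⁆ = ⁅x, p⁆ ^ m := by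
  induction m with
  | zero => simp
  | succ m ih => rw [pow_succ, commutatorElement_mul_left_of_mem_center _ h, ih, pow_succ]

end CommutatorCalculus

section Distortion

open scoped commutatorElement

variable {Γ : Type*} [Group Γ]

/-- The descending series `N, [Γ, N], [Γ, [Γ, N]], …`. -/
def relativeCentralSeries (N : Subgroup Γ) : ℕ → Subgroup Γ
  | 0 => N
  | k + 1 => ⁅(⊤ : Subgroup Γ), relativeCentralSeries N k⁆

instance relativeCentralSeries_normal (N : Subgroup Γ) [N.Normal] (k : ℕ) :
    (relativeCentralSeries N k).Normal := by
  induction k with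
  | zero => assumption
  | succ k ih => rw [relativeCentralSeries]; infer_instance

theorem relativeCentralSeries_succ_le (N : Subgroup Γ) [N.Normal] (k : ℕ) :
    relativeCentralSeries N (k + 1) ≤ relativeCentralSeries N k :=
  Subgroup.commutator_le_right _ _

theorem relativeCentralSeries_le_lowerCentralSeries (N : Subgroup Γ) (k : ℕ) :
    relativeCentralSeries N k ≤ (⊤ : Subgroup Γ).lowerCentralSeries k := by
  induction k with
  | zero => exact le_top
  | succ k ih =>
    rw [relativeCentralSeries, Subgroup.lowerCentralSeries_succ, Subgroup.commutator_comm]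
    exact Subgroup.commutator_mono ih le_rfl

theorem mk_mem_center_of_mem_relativeCentralSeries {N : Subgroup Γ} [N.Normal] {k : ℕ} {n : Γ}
    (hn : n ∈ relativeCentralSeries N k) :
    (n : Γ ⧸ relativeCentralSeries N (k + 1)) ∈ Subgroup.center _ := by
  rw [Subgroup.mem_center_iff]
  intro q
  induction q using QuotientGroup.induction_on with
  | H x =>
    have h : ⁅x, n⁆ ∈ relativeCentralSeries N (k + 1) :=
      Subgroup.commutator_mem_commutator (Subgroup.mem_top x) hn
    have h' := (QuotientGroup.eq_one_iff _).2 h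
    rw [← commutatorElement_eq_one_iff_mul_comm]
    exact h'

/-- An element that `σ` raises to a power of two and whose powers have bounded length,
both modulo `M`. -/
structure HasBoundedPowers (σ : Γ →* Γ) (F : Γ → ℝ) (M : Subgroup Γ) [M.Normal] (c : Γ) :
    Prop where
  map_eq : ∃ j : ℕ, (σ c : Γ ⧸ M) = (c : Γ ⧸ M) ^ 2 ^ j
  bounded : ∃ C : ℝ, ∀ m : ℕ, ∃ q : Γ, (q : Γ ⧸ M) = (c : Γ ⧸ M) ^ m ∧ F q ≤ C

variable {σ : Γ →* Γ} {F : Γ → ℝ}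

theorem length_commutatorElement_le (hmul : ∀ p q, F (p * q) ≤ F p + F q)
    (hinv : ∀ p, F p⁻¹ = F p) (x q : Γ) : F ⁅x, q⁆ ≤ 2 * F x + 2 * F q := by
  rw [commutatorElement_def]
  linarith [hmul (x * q * x⁻¹) q⁻¹, hmul (x * q) x⁻¹, hmul x q, hinv x, hinv q]

theorem HasBoundedPowers.commutatorElement {N : Subgroup Γ} [N.Normal] {k : ℕ}
    (hmul : ∀ p q, F (p * q) ≤ F p + F q) (hinv : ∀ p, F p⁻¹ = F p) {c x : Γ}
    (hck : c ∈ relativeCentralSeries N k)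
    (hc : HasBoundedPowers σ F (relativeCentralSeries N (k + 1)) c)
    (hx : ∃ i : ℕ, σ x = x ^ 2 ^ i) :
    HasBoundedPowers σ F (relativeCentralSeries N (k + 2)) ⁅x, c⁆ := by
  obtain ⟨i, hi⟩ := hx
  obtain ⟨⟨j, hj⟩, C, hC⟩ := hc
  have hcent : ∀ y : Γ,
      ⁅(y : Γ ⧸ relativeCentralSeries N (k + 2)), (c : Γ ⧸ relativeCentralSeries N (k + 2))⁆ ∈
        Subgroup.center (Γ ⧸ relativeCentralSeries N (k + 2)) := fun y =>
    mk_mem_center_of_mem_relativeCentralSeries (k := k + 1)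
      (Subgroup.commutator_mem_commutator (Subgroup.mem_top y) hck)
  have key : ∀ (y q : Γ) (m : ℕ), (q : Γ ⧸ relativeCentralSeries N (k + 1)) = (c : Γ ⧸ _) ^ m →
      ((⁅y, q⁆ : Γ) : Γ ⧸ relativeCentralSeries N (k + 2)) =
        ⁅(y : Γ ⧸ relativeCentralSeries N (k + 2)), (c : Γ ⧸ _)⁆ ^ m := by
    intro y q m hq
    have hmem : (c ^ m)⁻¹ * q ∈ relativeCentralSeries N (k + 1) :=
      QuotientGroup.eq.1 (by rw [hq]; rfl)
    have hz := mk_mem_center_of_mem_relativeCentralSeries hmem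
    set z := (c ^ m)⁻¹ * q with hzdef
    have hq' : q = c ^ m * z := by rw [hzdef]; group
    have hyz : ⁅(y : Γ ⧸ relativeCentralSeries N (k + 2)),
        (z : Γ ⧸ relativeCentralSeries N (k + 2))⁆ = 1 := by
      rw [commutatorElement_eq_one_iff_mul_comm]
      exact Subgroup.mem_center_iff.1 hz _
    calc ((⁅y, q⁆ : Γ) : Γ ⧸ relativeCentralSeries N (k + 2))
        = ⁅(y : Γ ⧸ relativeCentralSeries N (k + 2)), (c : Γ ⧸ _) ^ m * (z : Γ ⧸ _)⁆ := by
          rw [hq']; rfl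
      _ = _ := by
          rw [commutatorElement_mul_right_of_mem_center _ (by rw [hyz]; exact one_mem _), hyz,
            mul_one, commutatorElement_pow_right_of_mem_center (hcent y)]
  refine ⟨⟨i + j, ?_⟩, 2 * F x + 2 * C, fun m => ?_⟩
  · rw [map_commutatorElement, key _ _ _ hj, hi, pow_add, pow_mul]
    congr 1
    exact commutatorElement_pow_left_of_mem_center (hcent x) _
  · obtain ⟨q, hq, hqC⟩ := hC m
    exact ⟨⁅x, q⁆, key x q m hq,
      (length_commutatorElement_le hmul hinv x q).trans (by linarith)⟩

/-- Elements with bounded powers generate each term of the series modulo the next one. -/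
theorem relativeCentralSeries_le_closure_sup (hmul : ∀ p q, F (p * q) ≤ F p + F q)
    (hinv : ∀ p, F p⁻¹ = F p) {S : Set Γ} (hS : Subgroup.closure S = ⊤)
    (hσS : ∀ x ∈ S, ∃ i : ℕ, σ x = x ^ 2 ^ i) {b : Γ} (hσb : σ b = b)
    (hb : ∀ m : ℕ, F (b ^ m) = 0) (k : ℕ) :
    relativeCentralSeries (Subgroup.normalClosure {b}) k ≤
      Subgroup.closure {c | c ∈ relativeCentralSeries (Subgroup.normalClosure {b}) k ∧
        HasBoundedPowers σ F (relativeCentralSeries (Subgroup.normalClosure {b}) (k + 1)) c} ⊔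
      relativeCentralSeries (Subgroup.normalClosure {b}) (k + 1) := by
  set N := Subgroup.normalClosure {b} with hN
  have conj_mem : ∀ (k : ℕ) (R : Subgroup Γ), relativeCentralSeries N (k + 1) ≤ R →
      ∀ (x r : Γ), r ∈ relativeCentralSeries N k → r ∈ R → x * r * x⁻¹ ∈ R := by
    intro k R hR x r hrk hr
    have h1 : ⁅x, r⁆ ∈ R :=
      hR (Subgroup.commutator_mem_commutator (Subgroup.mem_top x) hrk)
    have : x * r * x⁻¹ = ⁅x, r⁆ * r := by simp only [commutatorElement_def]; group
    rw [this]
    exact mul_mem h1 hr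
  induction k with
  | zero =>
    set R := Subgroup.closure {c | c ∈ relativeCentralSeries N 0 ∧
        HasBoundedPowers σ F (relativeCentralSeries N (0 + 1)) c} ⊔
      relativeCentralSeries N (0 + 1) with hR
    have hbN : b ∈ N := Subgroup.subset_normalClosure rfl
    have hbR : b ∈ R := by
      refine Subgroup.mem_sup_left (Subgroup.subset_closure ⟨hbN, ⟨0, ?_⟩, 0, fun m => ?_⟩)
      · simp [hσb]
      · exact ⟨b ^ m, rfl, (hb m).le⟩
    change N ≤ R
    rw [hN, Subgroup.normalClosure, Subgroup.closure_le]
    intro y hy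
    obtain ⟨b', hb', hconj⟩ := Group.mem_conjugatesOfSet_iff.1 hy
    rw [Set.mem_singleton_iff.1 hb'] at hconj
    obtain ⟨g, rfl⟩ := isConj_iff.1 hconj
    exact conj_mem 0 R le_sup_right g b hbN hbR
  | succ k ih =>
    set R := Subgroup.closure {c | c ∈ relativeCentralSeries N (k + 1) ∧
        HasBoundedPowers σ F (relativeCentralSeries N (k + 1 + 1)) c} ⊔
      relativeCentralSeries N (k + 1 + 1) with hR
    have hR2 : relativeCentralSeries N (k + 2) ≤ R := le_sup_right
    have hcom : ∀ x : Γ, ∀ n ∈ relativeCentralSeries N k,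
        ⁅x, n⁆ ∈ relativeCentralSeries N (k + 1) := fun x n hn =>
      Subgroup.commutator_mem_commutator (Subgroup.mem_top x) hn
    have hgen : ∀ x ∈ S, ∀ n ∈ relativeCentralSeries N k, ⁅x, n⁆ ∈ R := by
      intro x hx
      let V : Subgroup Γ :=
        { carrier := {n | n ∈ relativeCentralSeries N k ∧ ⁅x, n⁆ ∈ R}
          one_mem' := ⟨one_mem _, by simp⟩
          mul_mem' := by
            rintro p q ⟨hp, hp'⟩ ⟨hq, hq'⟩
            refine ⟨mul_mem hp hq, ?_⟩
            have : ⁅x, p * q⁆ = ⁅x, p⁆ * (p * ⁅x, q⁆ * p⁻¹) := by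
              simp only [commutatorElement_def]; group
            rw [this]
            exact mul_mem hp' (conj_mem _ R hR2 p _ (hcom x q hq) hq')
          inv_mem' := by
            rintro p ⟨hp, hp'⟩
            refine ⟨inv_mem hp, ?_⟩
            have : ⁅x, p⁻¹⁆ = p⁻¹ * ⁅x, p⁆⁻¹ * p⁻¹⁻¹ := by
              simp only [commutatorElement_def]; group
            rw [this]
            exact conj_mem _ R hR2 _ _ (inv_mem (hcom x p hp)) (inv_mem hp') }
      have hV : relativeCentralSeries N k ≤ V := by
        refine ih.trans (sup_le ?_ ?_)
        · rw [Subgroup.closure_le]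
          rintro c ⟨hck, hc⟩
          exact ⟨hck, Subgroup.mem_sup_left (Subgroup.subset_closure
            ⟨hcom x c hck, hc.commutatorElement hmul hinv hck (hσS x hx)⟩)⟩
        · intro n hn
          exact ⟨relativeCentralSeries_succ_le N k hn, hR2
            (Subgroup.commutator_mem_commutator (Subgroup.mem_top x) hn)⟩
      exact fun n hn => (hV hn).2
    change ⁅(⊤ : Subgroup Γ), relativeCentralSeries N k⁆ ≤ R
    rw [Subgroup.commutator_le]
    intro x _ n hn
    have hx : x ∈ Subgroup.closure S := hS ▸ Subgroup.mem_top x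
    induction hx using Subgroup.closure_induction with
    | mem x hx => exact hgen x hx n hn
    | one => simp
    | mul x y _ _ hx hy =>
      have : ⁅x * y, n⁆ = (x * ⁅y, n⁆ * x⁻¹) * ⁅x, n⁆ := by
        simp only [commutatorElement_def]; group
      rw [this]
      exact mul_mem (conj_mem _ R hR2 _ _ (hcom y n hn) (hy trivial)) (hx trivial)
    | inv x _ hx =>
      have : ⁅x⁻¹, n⁆ = x⁻¹ * ⁅x, n⁆⁻¹ * x⁻¹⁻¹ := by
        simp only [commutatorElement_def]; group
      rw [this]
      exact conj_mem _ R hR2 _ _ (inv_mem (hcom x n hn)) (inv_mem (hx trivial))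

/-- If `σ` doubles the length `F` on a nilpotent group, fixes `b` and raises some generators to
powers of two, then `F` vanishes on the normal closure of `b`. -/
theorem length_eq_zero_of_mem_normalClosure [Group.IsNilpotent Γ]
    (hnonneg : ∀ p, 0 ≤ F p) (hmul : ∀ p q, F (p * q) ≤ F p + F q)
    (hinv : ∀ p, F p⁻¹ = F p) (hσ : ∀ p, F (σ p) = 2 * F p)
    {S : Set Γ} (hS : Subgroup.closure S = ⊤)
    (hσS : ∀ x ∈ S, ∃ i : ℕ, σ x = x ^ 2 ^ i) {b : Γ} (hσb : σ b = b) {p : Γ}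
    (hp : p ∈ Subgroup.normalClosure {b}) : F p = 0 := by
  have hfix : ∀ p, σ p = p → F p = 0 := fun p h => by linarith [h ▸ hσ p]
  have hb : ∀ m : ℕ, F (b ^ m) = 0 := fun m => hfix _ (by rw [map_pow, hσb])
  let K : Subgroup Γ :=
    { carrier := {p | F p = 0}
      one_mem' := hfix 1 (map_one σ)
      mul_mem' := by
        intro p q (hp : F p = 0) (hq : F q = 0)
        exact le_antisymm ((hmul p q).trans (by rw [hp, hq, add_zero])) (hnonneg _)
      inv_mem' := fun {p} hp => (hinv p).trans hp }
  set N := Subgroup.normalClosure {b}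
  have hK : ∀ {M : Subgroup Γ} [M.Normal], M ≤ K → ∀ {p q : Γ}, (p : Γ ⧸ M) = q → F p = F q := by
    intro M _ hM
    have : ∀ {p q : Γ}, (p : Γ ⧸ M) = q → F q ≤ F p := by
      intro p q h
      have h0 : F (p⁻¹ * q) = 0 := hM (QuotientGroup.eq.1 h)
      have := hmul p (p⁻¹ * q)
      rw [mul_inv_cancel_left, h0] at this
      linarith
    exact fun {p q} h => le_antisymm (this h.symm) (this h)
  have hstep : ∀ k, relativeCentralSeries N (k + 1) ≤ K → relativeCentralSeries N k ≤ K := by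
    intro k hk
    refine (relativeCentralSeries_le_closure_sup hmul hinv hS hσS hσb hb k).trans
      (sup_le ?_ hk)
    rw [Subgroup.closure_le]
    rintro c ⟨-, ⟨j, hj⟩, C, hC⟩
    have hpow : ∀ i : ℕ, F (c ^ (2 ^ j) ^ i) = 2 ^ i * F c := by
      intro i
      induction i with
      | zero => simp
      | succ i ih =>
        have : F (c ^ (2 ^ j) ^ (i + 1)) = F (σ (c ^ (2 ^ j) ^ i)) := by
          refine hK hk ?_
          rw [map_pow, QuotientGroup.mk_pow, QuotientGroup.mk_pow, hj, pow_succ' (2 ^ j) i, pow_mul]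
        rw [this, hσ, ih]
        ring
    by_contra hne
    have hpos : 0 < F c := lt_of_le_of_ne (hnonneg c) (Ne.symm hne)
    obtain ⟨i, hi⟩ := pow_unbounded_of_one_lt (C / F c) (one_lt_two (α := ℝ))
    obtain ⟨q, hq, hqC⟩ := hC ((2 ^ j) ^ i)
    have h1 : F q = 2 ^ i * F c :=
      (hK hk (hq.trans (QuotientGroup.mk_pow _ _ _).symm)).trans (hpow i)
    rw [div_lt_iff₀ hpos] at hi
    linarith
  obtain ⟨n, hn⟩ := Subgroup.nilpotent_iff_lowerCentralSeries.1 ‹Group.IsNilpotent Γ›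
  have hall : ∀ d k, k + d = n → relativeCentralSeries N k ≤ K := by
    intro d
    induction d with
    | zero =>
      rintro k rfl
      exact (relativeCentralSeries_le_lowerCentralSeries N _).trans (hn.le.trans bot_le)
    | succ d ih => exact fun k hk => hstep k (ih (k + 1) (by omega))
  exact hall n 0 (zero_add n) hp

theorem ENNReal.limsup_add_le_add {ι : Type*} (l : Filter ι) (u v : ι → ENNReal) :
    limsup (fun i => u i + v i) l ≤ limsup u l + limsup v l := by
  refine ENNReal.le_of_forall_pos_le_add fun ε hε hfin => ?_
  obtain ⟨hu, hv⟩ := ENNReal.add_lt_top.1 hfin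
  have hε2 : ((ε / 2 : NNReal) : ENNReal) ≠ 0 := by simpa using hε.ne'
  have h1 := eventually_lt_of_limsup_lt (ENNReal.lt_add_right hu.ne hε2)
  have h2 := eventually_lt_of_limsup_lt (ENNReal.lt_add_right hv.ne hε2)
  refine limsup_le_of_le (h := ?_)
  filter_upwards [h1, h2] with i h1 h2
  refine (add_le_add h1.le h2.le).trans_eq ?_
  rw [add_add_add_comm, ← ENNReal.coe_add, add_halves]

/-- The asymptotic growth, relative to `2 ^ k`, of the length of a sequence in `G`. -/
noncomputable def dyadicGrowth {G : Type*} (L : G → ℝ) (p : ℕ → G) : ENNReal :=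
  limsup (fun k => ENNReal.ofReal (L (p k) / 2 ^ k)) atTop

theorem dyadicGrowth_shift {G : Type*} (L : G → ℝ) (p : ℕ → G) :
    dyadicGrowth L (fun k => p (k + 1)) = 2 * dyadicGrowth L p := by
  unfold dyadicGrowth
  rw [← limsup_nat_add (fun k => ENNReal.ofReal (L (p k) / 2 ^ k)) 1,
    ← ENNReal.limsup_const_mul_of_ne_top (by simp)]
  congr 1
  ext k
  rw [show (2 : ENNReal) = ENNReal.ofReal 2 by simp, ← ENNReal.ofReal_mul (by norm_num)]
  congr 1
  rw [pow_succ]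
  field_simp

theorem dyadicGrowth_le {G : Type*} {L : G → ℝ} (p : ℕ → G) (C : ℝ)
    (h : ∀ k, L (p k) ≤ C * 2 ^ k) :
    dyadicGrowth L p ≤ ENNReal.ofReal C :=
  limsup_le_of_le (h := Eventually.of_forall fun k =>
    ENNReal.ofReal_le_ofReal ((div_le_iff₀ (by positivity)).2 (h k)))

section DyadicGrowth

variable {G : Type*} [Group G] {L : G → ℝ}

theorem dyadicGrowth_mul_le (hmul : ∀ p q, L (p * q) ≤ L p + L q) (p q : ℕ → G) :
    dyadicGrowth L (p * q) ≤ dyadicGrowth L p + dyadicGrowth L q := by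
  refine le_trans (limsup_le_limsup (Eventually.of_forall fun k => ?_))
    (ENNReal.limsup_add_le_add _ _ _)
  refine le_trans (ENNReal.ofReal_le_ofReal ?_) ENNReal.ofReal_add_le
  rw [← add_div]
  gcongr
  exact hmul _ _

theorem dyadicGrowth_inv (hinv : ∀ p, L p⁻¹ = L p) (p : ℕ → G) :
    dyadicGrowth L p⁻¹ = dyadicGrowth L p := by
  simp only [dyadicGrowth, Pi.inv_apply, hinv]

theorem length_pow_le (hmul : ∀ p q, L (p * q) ≤ L p + L q) (g : G) (n : ℕ) :
    L (g ^ n) ≤ L 1 + n * L g := by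
  induction n with
  | zero => simp
  | succ n ih =>
    rw [pow_succ]
    push_cast
    linarith [hmul (g ^ n) g]

/-- In a nilpotent group, the commutator of `g ^ n` with a fixed element has length `o(n)`
along `n = 2 ^ k`, for any length function. -/
theorem tendsto_length_commutatorElement_div [Group.IsNilpotent G]
    (hnonneg : ∀ p, 0 ≤ L p) (hmul : ∀ p q, L (p * q) ≤ L p + L q)
    (hinv : ∀ p, L p⁻¹ = L p) (g h : G) :
    Tendsto (fun k : ℕ => L ⁅g ^ 2 ^ k, h⁆ / 2 ^ k) atTop (nhds 0) := by
  have : Group.IsNilpotent (ℕ → G) :=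
    Group.isNilpotent_pi_of_bounded_class (Group.nilpotencyClass G) fun _ => le_rfl
  let shift : (ℕ → G) →* (ℕ → G) :=
    { toFun := fun p k => p (k + 1), map_one' := rfl, map_mul' := fun _ _ => rfl }
  let a : ℕ → G := fun k => g ^ 2 ^ k
  let b : ℕ → G := fun _ => h
  have hshift_a : shift a = a ^ 2 := by
    ext k
    change g ^ 2 ^ (k + 1) = (g ^ 2 ^ k) ^ 2
    rw [pow_succ, pow_mul]
  let Γ : Subgroup (ℕ → G) := Subgroup.closure {a, b}
  have ha : a ∈ Γ := Subgroup.subset_closure (by simp)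
  have hb : b ∈ Γ := Subgroup.subset_closure (by simp)
  have hfin : ∀ p ∈ Γ, dyadicGrowth L p ≠ ⊤ := by
    intro p hp
    induction hp using Subgroup.closure_induction with
    | mem x hx =>
      rcases hx with rfl | rfl
      · refine ne_top_of_le_ne_top ENNReal.ofReal_ne_top
          (dyadicGrowth_le a (L 1 + L g) fun k => ?_)
        have h1 := length_pow_le hmul g (2 ^ k)
        have h2 := mul_le_mul_of_nonneg_left (one_le_pow₀ (one_le_two (α := ℝ)) (n := k))
          (hnonneg 1)
        push_cast at h1
        linarith
      · exact ne_top_of_le_ne_top ENNReal.ofReal_ne_top (dyadicGrowth_le b (L h) fun k =>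
          le_mul_of_one_le_right (hnonneg h) (one_le_pow₀ one_le_two))
    | one =>
      exact ne_top_of_le_ne_top ENNReal.ofReal_ne_top (dyadicGrowth_le 1 (L 1) fun k =>
          le_mul_of_one_le_right (hnonneg 1) (one_le_pow₀ one_le_two))
    | mul x y _ _ hx hy =>
      exact ne_top_of_le_ne_top (ENNReal.add_ne_top.2 ⟨hx, hy⟩) (dyadicGrowth_mul_le hmul x y)
    | inv x _ hx => rwa [dyadicGrowth_inv hinv]
  have hshift : Γ ≤ Γ.comap shift := by
    rw [Subgroup.closure_le]
    rintro x (rfl | rfl)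
    · change shift a ∈ Γ
      rw [hshift_a]
      exact pow_mem ha 2
    · exact hb
  let σ : Γ →* Γ := (shift.comp Γ.subtype).codRestrict Γ fun p => hshift p.2
  have hzero := length_eq_zero_of_mem_normalClosure (Γ := Γ) (σ := σ)
    (F := fun p => (dyadicGrowth L p.1).toReal) (S := {⟨a, ha⟩, ⟨b, hb⟩}) (b := ⟨b, hb⟩)
    (p := ⁅(⟨a, ha⟩ : Γ), ⟨b, hb⟩⁆)
    (fun _ => ENNReal.toReal_nonneg)
    (fun p q => by
      rw [← ENNReal.toReal_add (hfin _ p.2) (hfin _ q.2)]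
      exact ENNReal.toReal_mono (ENNReal.add_ne_top.2 ⟨hfin _ p.2, hfin _ q.2⟩)
        (dyadicGrowth_mul_le hmul _ _))
    (fun p => congrArg ENNReal.toReal (dyadicGrowth_inv hinv p.1))
    (fun p => by
      refine (congrArg ENNReal.toReal (dyadicGrowth_shift L p.1)).trans ?_
      simp)
    (by
      rw [eq_top_iff, ← Subgroup.map_subtype_le_map_subtype, MonoidHom.map_closure]
      simp [Set.image_insert_eq, Γ, ← MonoidHom.range_eq_map])
    (by
      rintro x (rfl | rfl)
      · exact ⟨1, Subtype.ext hshift_a⟩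
      · exact ⟨0, Subtype.ext (by simp; rfl)⟩)
    rfl
    (by
      have hN : (⟨b, hb⟩ : Γ) ∈ Subgroup.normalClosure {(⟨b, hb⟩ : Γ)} :=
        Subgroup.subset_normalClosure rfl
      exact mul_mem (Subgroup.normalClosure_normal.conj_mem _ hN _) (inv_mem hN))
  have hlim : dyadicGrowth L ⁅a, b⁆ = 0 :=
    ((ENNReal.toReal_eq_zero_iff _).1 hzero).resolve_right
      (hfin _ (⁅(⟨a, ha⟩ : Γ), ⟨b, hb⟩⁆ : Γ).2)
  have ht : Tendsto (fun k => ENNReal.ofReal (L ⁅g ^ 2 ^ k, h⁆ / 2 ^ k)) atTop (nhds 0) :=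
    tendsto_of_le_liminf_of_limsup_le bot_le hlim.le
  have ht' := (ENNReal.tendsto_toReal ENNReal.zero_ne_top).comp ht
  refine ht'.congr fun k => ?_
  exact ENNReal.toReal_ofReal (div_nonneg (hnonneg _) (by positivity))

end DyadicGrowth

end Distortion

theorem ENNReal.liminf_add_le_add {ι : Type*} (l : Filter ι) (u v : ι → ENNReal) :
    liminf (fun i => u i + v i) l ≤ liminf u l + limsup v l := by
  refine ENNReal.le_of_forall_pos_le_add fun ε hε hfin => ?_
  obtain ⟨hu, hv⟩ := ENNReal.add_lt_top.1 hfin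
  have hε2 : ((ε / 2 : NNReal) : ENNReal) ≠ 0 := by simpa using hε.ne'
  have h1 := frequently_lt_of_liminf_lt (h := ENNReal.lt_add_right hu.ne hε2)
  have h2 := eventually_lt_of_limsup_lt (ENNReal.lt_add_right hv.ne hε2)
  refine liminf_le_of_frequently_le ((h1.and_eventually h2).mono fun i h => ?_)
  refine (add_le_add h.1.le h.2.le).trans_eq ?_
  rw [add_add_add_comm, ← ENNReal.coe_add, add_halves]

theorem ENNReal.tendsto_const_div_natCast {a : ENNReal} (ha : a ≠ ⊤) :
    Tendsto (fun n : ℕ => a / n) atTop (nhds 0) := by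
  simpa using ENNReal.Tendsto.const_div ENNReal.tendsto_nat_nhds_top (Or.inr ha)

section Ergodic

variable {X : Type*} {T : X → X}

theorem birkhoffSum_le_birkhoffSum_add {h : X → ENNReal} (m n : ℕ) (x : X) :
    birkhoffSum T h m x ≤ birkhoffSum T h (m + n) x := by
  rw [birkhoffSum_add]
  exact le_self_add

theorem birkhoffSum_le_mul {h : X → ENNReal} {c : ENNReal} (hc : ∀ x, h x ≤ c) (n : ℕ) (x : X) :
    birkhoffSum T h n x ≤ n * c := by
  refine (Finset.sum_le_sum fun k _ => hc (T^[k] x)).trans_eq ?_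
  simp

/-- Covering argument for the maximal inequality. -/
theorem birkhoffSum_indicator_le {h : X → ENNReal} {c : ENNReal} {E : Set X} {K : ℕ}
    (hE : ∀ x ∈ E, ∃ m, 1 ≤ m ∧ m ≤ K ∧ m * c ≤ birkhoffSum T h m x) (n : ℕ) (x : X) :
    birkhoffSum T (E.indicator fun _ => c) n x ≤ birkhoffSum T h (n + K) x := by
  induction n using Nat.strong_induction_on generalizing x with
  | h n ih =>
  have hc : ∀ x, E.indicator (fun _ => c) x ≤ c := Set.indicator_le_self _ _
  by_cases hx : x ∈ E
  · obtain ⟨m, hm1, hmK, hm⟩ := hE x hx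
    rcases le_total m n with hmn | hmn
    · obtain ⟨d, rfl⟩ := Nat.exists_eq_add_of_le hmn
      rw [birkhoffSum_add, add_assoc, birkhoffSum_add]
      exact add_le_add ((birkhoffSum_le_mul hc m x).trans hm) (ih d (by omega) _)
    · obtain ⟨d, hd⟩ := Nat.exists_eq_add_of_le (show m ≤ n + K by omega)
      rw [hd]
      calc _ ≤ (n : ENNReal) * c := birkhoffSum_le_mul hc n x
        _ ≤ m * c := by gcongr
        _ ≤ _ := hm.trans (birkhoffSum_le_birkhoffSum_add _ _ _)
  · cases n with
    | zero => simp
    | succ n =>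
      rw [birkhoffSum_succ', Set.indicator_of_notMem hx, zero_add, Nat.add_right_comm,
        birkhoffSum_succ']
      exact (ih n (by omega) _).trans le_add_self

variable [MeasurableSpace X] {μ : Measure X}

theorem measurable_birkhoffSum (hT : Measurable T) {h : X → ENNReal} (hh : Measurable h) (n : ℕ) :
    Measurable (birkhoffSum T h n) :=
  Finset.measurable_fun_sum _ fun k _ => hh.comp (hT.iterate k)

theorem lintegral_birkhoffSum (hT : MeasurePreserving T μ μ) {h : X → ENNReal}
    (hh : Measurable h) (n : ℕ) : ∫⁻ x, birkhoffSum T h n x ∂μ = n * ∫⁻ x, h x ∂μ := by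
  unfold birkhoffSum
  rw [lintegral_finsetSum (f := fun k x => h (T^[k] x)) _
    fun k _ => hh.comp (hT.measurable.iterate k)]
  simp [(hT.iterate _).lintegral_comp hh]

theorem mul_measure_le_of_forall_exists_le (hT : MeasurePreserving T μ μ) {h : X → ENNReal}
    (hh : Measurable h) {c : ENNReal} {E : Set X} (hEm : MeasurableSet E) {K : ℕ}
    (hE : ∀ x ∈ E, ∃ m, 1 ≤ m ∧ m ≤ K ∧ m * c ≤ birkhoffSum T h m x) :
    c * μ E ≤ ∫⁻ x, h x ∂μ := by
  by_cases hI : ∫⁻ x, h x ∂μ = ⊤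
  · rw [hI]; exact le_top
  have hn : ∀ n : ℕ, n * (c * μ E) ≤ (n + K) * ∫⁻ x, h x ∂μ := by
    intro n
    have := lintegral_mono (μ := μ) fun x => birkhoffSum_indicator_le hE n x
    rwa [lintegral_birkhoffSum hT (measurable_const.indicator hEm), lintegral_birkhoffSum hT hh,
      lintegral_indicator_const hEm, Nat.cast_add] at this
  have hlim : Tendsto (fun n : ℕ => ∫⁻ x, h x ∂μ + K * (∫⁻ x, h x ∂μ) / n) atTop
      (nhds (∫⁻ x, h x ∂μ + 0)) :=
    tendsto_const_nhds.add (ENNReal.tendsto_const_div_natCast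
      (ENNReal.mul_ne_top (ENNReal.natCast_ne_top K) hI))
  rw [add_zero] at hlim
  refine ge_of_tendsto hlim ?_
  filter_upwards [eventually_ge_atTop 1] with n hn1
  have hn0 : (n : ENNReal) ≠ 0 := by exact_mod_cast (by omega : n ≠ 0)
  rw [← ENNReal.mul_le_mul_iff_right hn0 (ENNReal.natCast_ne_top n), mul_add,
    ENNReal.mul_div_cancel hn0 (ENNReal.natCast_ne_top n), ← add_mul]
  exact hn n

/-- The maximal ergodic inequality for nonnegative functions. -/
theorem mul_measure_maximal_le (hT : MeasurePreserving T μ μ) {h : X → ENNReal}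
    (hh : Measurable h) (c : ENNReal) :
    c * μ {x | ∃ m : ℕ, 1 ≤ m ∧ m * c ≤ birkhoffSum T h m x} ≤ ∫⁻ x, h x ∂μ := by
  let E : ℕ → Set X := fun K => {x | ∃ m : ℕ, 1 ≤ m ∧ m ≤ K ∧ m * c ≤ birkhoffSum T h m x}
  have hEmono : Monotone E := fun K K' hK x ⟨m, h1, h2, h3⟩ => ⟨m, h1, h2.trans hK, h3⟩
  have hEm : ∀ K, MeasurableSet (E K) := by
    intro K
    have : E K = ⋃ m ∈ Finset.Icc 1 K, {x | (m : ENNReal) * c ≤ birkhoffSum T h m x} := by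
      ext x
      simp [E, and_assoc]
    rw [this]
    exact Finset.measurableSet_biUnion _ fun m _ =>
      measurableSet_le measurable_const (measurable_birkhoffSum hT.measurable hh m)
  have hU : {x | ∃ m : ℕ, 1 ≤ m ∧ m * c ≤ birkhoffSum T h m x} = ⋃ K, E K := by
    ext x
    simp only [E, Set.mem_iUnion]
    exact ⟨fun ⟨m, h1, h2⟩ => ⟨m, m, h1, le_rfl, h2⟩, fun ⟨K, m, h1, _, h2⟩ => ⟨m, h1, h2⟩⟩
  rw [hU, hEmono.measure_iUnion, ENNReal.mul_iSup]
  exact iSup_le fun K => mul_measure_le_of_forall_exists_le hT hh (hEm K) fun x hx => hx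

theorem ae_tendsto_comp_iterate_div [IsProbabilityMeasure μ] (hT : MeasurePreserving T μ μ)
    {h : X → ENNReal} (hh : Measurable h) (hI : ∫⁻ x, h x ∂μ ≠ ⊤) :
    ∀ᵐ x ∂μ, Tendsto (fun n : ℕ => h (T^[n] x) / n) atTop (nhds 0) := by
  have hsum : ∀ i : ℕ, ∑' n : ℕ, μ {x | (n : ENNReal) < (i + 1) * h x} ≠ ⊤ := by
    intro i
    let _ : MeasureSpace X := ⟨μ⟩
    have hint : Integrable (fun x => ((i : ℝ) + 1) * (h x).toReal) μ :=
      (integrable_toReal_of_lintegral_ne_top hh.aemeasurable hI).const_mul _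
    have := ProbabilityTheory.tsum_prob_mem_Ioi_lt_top hint
      (fun x => mul_nonneg (by positivity) ENNReal.toReal_nonneg)
    refine ne_top_of_le_ne_top this.ne (ENNReal.tsum_le_tsum fun n => ?_)
    refine measure_mono_ae ?_
    filter_upwards [ae_lt_top hh hI] with x hx hlt
    change (n : ENNReal) < (i + 1) * h x at hlt
    have hne : ((i : ENNReal) + 1) * h x ≠ ⊤ := ENNReal.mul_ne_top (by finiteness) hx.ne
    have := (ENNReal.toReal_lt_toReal (ENNReal.natCast_ne_top n) hne).2 hlt
    change (n : ℝ) < ((i : ℝ) + 1) * (h x).toReal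
    simpa [ENNReal.toReal_mul, ENNReal.toReal_add] using this
  have hBC : ∀ i : ℕ, ∀ᵐ x ∂μ, ∀ᶠ n : ℕ in atTop, (i + 1) * h (T^[n] x) ≤ n := by
    intro i
    have hpre : ∀ n : ℕ, μ {x | (n : ENNReal) < (i + 1) * h (T^[n] x)} =
        μ {x | (n : ENNReal) < (i + 1) * h x} := fun n =>
      (hT.iterate n).measure_preimage
        (measurableSet_lt measurable_const (hh.const_mul _)).nullMeasurableSet
    have h0 := measure_setOfPred_frequently_eq_zero (μ := μ)
      (p := fun n x => (n : ENNReal) < (i + 1) * h (T^[n] x)) (by simpa only [hpre] using hsum i)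
    filter_upwards [measure_eq_zero_iff_ae_notMem.1 h0] with x hx
    simpa [not_frequently] using hx
  filter_upwards [ae_all_iff.2 hBC] with x hx
  rw [ENNReal.tendsto_nhds_zero]
  intro ε hε
  obtain ⟨i, hi⟩ := ENNReal.exists_inv_nat_lt hε.ne'
  filter_upwards [hx i, eventually_ge_atTop 1] with n hn hn1
  have hi1 : ((i : ENNReal) + 1) ≠ 0 := by simp
  have hle : h (T^[n] x) ≤ n * (i : ENNReal)⁻¹ := by
    calc h (T^[n] x) ≤ n / (i + 1) := by
          rw [ENNReal.le_div_iff_mul_le (Or.inl hi1) (Or.inl (by finiteness)), mul_comm]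
          exact hn
      _ ≤ n * (i : ENNReal)⁻¹ := by
          rw [div_eq_mul_inv]
          gcongr
          exact le_self_add
  refine ENNReal.div_le_of_le_mul ?_
  rw [mul_comm]
  exact hle.trans (by gcongr)

theorem ae_forall_iterate (hT : MeasurePreserving T μ μ) {p : X → Prop} (hp : ∀ᵐ x ∂μ, p x) :
    ∀ᵐ x ∂μ, ∀ k, p (T^[k] x) :=
  ae_all_iff.2 fun k => (hT.iterate k).quasiMeasurePreserving.ae hp

end Ergodic

section Subadditive

variable {X : Type*} {T : X → X} {s : ℕ → X → ENNReal} {D : Set X}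

theorem le_birkhoffSum_of_subadditive (hD : ∀ x ∈ D, T x ∈ D)
    (hsub : ∀ x ∈ D, ∀ m n, s (m + n) x ≤ s m (T^[n] x) + s n x) {n : ℕ} (hn : 1 ≤ n)
    {x : X} (hx : x ∈ D) : s n x ≤ birkhoffSum T (s 1) n x := by
  induction n, hn using Nat.le_induction generalizing x with
  | base => simp
  | succ n _ ih =>
    rw [birkhoffSum_succ', add_comm (s 1 x)]
    exact (hsub x hx n 1).trans (add_le_add_left (ih (hD x hx)) _)

/-- The sum of `h` over the last `K` points of the orbit segment of length `n`. -/
noncomputable def birkhoffTail (T : X → X) (h : X → ENNReal) (K n : ℕ) (x : X) : ENNReal :=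
  ∑ k ∈ Finset.range n, if n ≤ k + K then h (T^[k] x) else 0

theorem birkhoffTail_of_le {h : X → ENNReal} {K n : ℕ} (hn : n ≤ K) (x : X) :
    birkhoffTail T h K n x = birkhoffSum T h n x :=
  Finset.sum_congr rfl fun k _ => if_pos (by omega)

theorem birkhoffTail_iterate_le (h : X → ENNReal) (K m n : ℕ) (x : X) :
    birkhoffTail T h K n (T^[m] x) ≤ birkhoffTail T h K (m + n) x := by
  unfold birkhoffTail
  rw [Finset.sum_range_add]
  refine le_add_left (Finset.sum_le_sum fun k _ => ?_)
  rw [add_comm m k, Function.iterate_add_apply]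
  exact (if_congr (by omega) rfl rfl).le

theorem birkhoffTail_add (h : X → ENNReal) (K n : ℕ) (x : X) :
    birkhoffTail T h K (n + K) x = ∑ j ∈ Finset.range K, h (T^[n + j] x) := by
  unfold birkhoffTail
  rw [Finset.sum_range_add, Finset.sum_eq_zero, zero_add]
  · exact Finset.sum_congr rfl fun j _ => if_pos (by omega)
  · intro k hk
    exact if_neg (by have := Finset.mem_range.1 hk; omega)

/-- Cutting an orbit segment greedily into blocks along which `s` grows slowly. -/
theorem le_add_birkhoffSum_indicator_add_birkhoffTail {r : X → ENNReal} {B : Set X} {K : ℕ}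
    (hK : 1 ≤ K) (hD : ∀ x ∈ D, T x ∈ D)
    (hsub : ∀ x ∈ D, ∀ m n, s (m + n) x ≤ s m (T^[n] x) + s n x)
    (hr : ∀ x ∈ D, r (T x) = r x)
    (hB : ∀ x ∈ D, x ∉ B → ∃ m, 1 ≤ m ∧ m ≤ K ∧ s m x ≤ m * r x)
    {n : ℕ} (hn : 1 ≤ n) {x : X} (hx : x ∈ D) :
    s n x ≤ n * r x + birkhoffSum T (B.indicator (s 1)) n x + birkhoffTail T (s 1) K n x := by
  have hDk : ∀ k, ∀ x ∈ D, T^[k] x ∈ D ∧ r (T^[k] x) = r x := by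
    intro k
    induction k with
    | zero => exact fun x hx => ⟨hx, rfl⟩
    | succ k ih =>
      intro x hx
      rw [Function.iterate_succ_apply]
      exact ⟨(ih _ (hD x hx)).1, ((ih _ (hD x hx)).2).trans (hr x hx)⟩
  induction n using Nat.strong_induction_on generalizing x with
  | h n ih =>
  rcases le_or_gt n K with hnK | hnK
  · rw [birkhoffTail_of_le hnK]
    exact le_add_left (le_birkhoffSum_of_subadditive hD hsub hn hx)
  have step : ∀ m, 1 ≤ m → m ≤ K →
      s m x ≤ m * r x + birkhoffSum T (B.indicator (s 1)) m x →
      s n x ≤ n * r x + birkhoffSum T (B.indicator (s 1)) n x + birkhoffTail T (s 1) K n x := by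
    intro m hm1 hmK hm
    obtain ⟨d, rfl⟩ := Nat.exists_eq_add_of_le (show m ≤ n by omega)
    have h1 := ih d (by omega) (by omega) (hDk m x hx).1
    rw [(hDk m x hx).2] at h1
    calc s (m + d) x ≤ s d (T^[m] x) + s m x := by rw [add_comm m d]; exact hsub x hx d m
      _ ≤ (d * r x + birkhoffSum T (B.indicator (s 1)) d (T^[m] x)
            + birkhoffTail T (s 1) K (m + d) x)
          + (m * r x + birkhoffSum T (B.indicator (s 1)) m x) :=
        add_le_add (h1.trans (by gcongr; exact birkhoffTail_iterate_le _ _ _ _ _)) hm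
      _ = _ := by
        rw [birkhoffSum_add]
        push_cast
        ring
  by_cases hxB : x ∈ B
  · exact step 1 le_rfl hK (by simp [hxB])
  · obtain ⟨m, h1, h2, h3⟩ := hB x hx hxB
    exact step m h1 h2 (h3.trans le_self_add)

variable [MeasurableSpace X] {μ : Measure X}

theorem ae_tendsto_birkhoffTail_div [IsProbabilityMeasure μ] (hT : MeasurePreserving T μ μ)
    {h : X → ENNReal} (hh : Measurable h) (hI : ∫⁻ x, h x ∂μ ≠ ⊤) (K : ℕ) :
    ∀ᵐ x ∂μ, Tendsto (fun n : ℕ => birkhoffTail T h K n x / n) atTop (nhds 0) := by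
  filter_upwards [ae_tendsto_comp_iterate_div hT hh hI] with x hx
  rw [← tendsto_add_atTop_iff_nat K]
  have hlim : Tendsto (fun n : ℕ => ∑ j ∈ Finset.range K, h (T^[n + j] x) / (n + j : ℕ)) atTop
      (nhds (∑ j ∈ Finset.range K, 0)) :=
    tendsto_finsetSum _ fun j _ => (tendsto_add_atTop_iff_nat j).2 hx
  rw [Finset.sum_const_zero] at hlim
  refine tendsto_of_tendsto_of_tendsto_of_le_of_le tendsto_const_nhds hlim (fun _ => zero_le)
    fun n => ?_
  simp only [birkhoffTail_add, ENNReal.div_eq_inv_mul, Finset.mul_sum]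
  refine Finset.sum_le_sum fun j hj => ?_
  have := (Finset.mem_range.1 hj).le
  gcongr

theorem lintegral_le_mul_of_subadditive (hT : MeasurePreserving T μ μ)
    (hs : ∀ n, Measurable (s n))
    (hsub : ∀ m n, ∀ᵐ x ∂μ, s (m + n) x ≤ s m (T^[n] x) + s n x) {n : ℕ} (hn : 1 ≤ n) :
    ∫⁻ x, s n x ∂μ ≤ n * ∫⁻ x, s 1 x ∂μ := by
  rw [← lintegral_birkhoffSum hT (hs 1)]
  refine lintegral_mono_ae ?_
  filter_upwards [ae_forall_iterate hT (ae_all_iff.2 fun m => ae_all_iff.2 fun n => hsub m n)]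
    with x hx
  refine le_birkhoffSum_of_subadditive
    (D := {x | ∀ k m n, s (m + n) (T^[k] x) ≤ s m (T^[n] (T^[k] x)) + s n (T^[k] x)})
    (fun y hy k => ?_) (fun y hy => hy 0) hn hx
  exact hy (k + 1)

theorem lintegral_liminf_div_le (hT : MeasurePreserving T μ μ)
    (hs : ∀ n, Measurable (s n))
    (hsub : ∀ m n, ∀ᵐ x ∂μ, s (m + n) x ≤ s m (T^[n] x) + s n x) :
    ∫⁻ x, liminf (fun n : ℕ => s n x / n) atTop ∂μ ≤ ∫⁻ x, s 1 x ∂μ := by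
  refine (lintegral_liminf_le fun n => (hs n).div_const _).trans ?_
  refine liminf_le_of_frequently_le (Eventually.frequently ?_)
  filter_upwards [eventually_ge_atTop 1] with n hn
  simp only [div_eq_mul_inv]
  rw [lintegral_mul_const _ (hs n), ← div_eq_mul_inv]
  refine ENNReal.div_le_of_le_mul ?_
  rw [mul_comm]
  exact lintegral_le_mul_of_subadditive hT hs hsub hn

theorem ae_liminf_div_comp_eq (hT : MeasurePreserving T μ μ)
    (hs : ∀ n, Measurable (s n)) (hI : ∫⁻ x, s 1 x ∂μ ≠ ⊤)
    (hsub : ∀ m n, ∀ᵐ x ∂μ, s (m + n) x ≤ s m (T^[n] x) + s n x) :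
    ∀ᵐ x ∂μ, liminf (fun n : ℕ => s n (T x) / n) atTop = liminf (fun n : ℕ => s n x / n) atTop := by
  have hm : Measurable fun x => liminf (fun n : ℕ => s n x / n) atTop :=
    Measurable.liminf fun n => (hs n).div_const _
  have hle : ∀ᵐ x ∂μ,
      liminf (fun n : ℕ => s n x / n) atTop ≤ liminf (fun n : ℕ => s n (T x) / n) atTop := by
    filter_upwards [ae_all_iff.2 fun m => hsub m 1, ae_lt_top (hs 1) hI] with x hx hx1
    calc liminf (fun n : ℕ => s n x / n) atTop
        = liminf (fun n : ℕ => s (n + 1) x / (n + 1 : ℕ)) atTop :=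
          (liminf_nat_add (fun n : ℕ => s n x / n) 1).symm
      _ ≤ liminf (fun n : ℕ => s n (T x) / n + s 1 x / n) atTop := by
          refine liminf_le_liminf (Eventually.of_forall fun n => ?_)
          rw [← ENNReal.add_div]
          exact ENNReal.div_le_div (hx n) (by simp)
      _ ≤ _ := by
          refine (ENNReal.liminf_add_le_add _ _ _).trans_eq ?_
          rw [(ENNReal.tendsto_const_div_natCast hx1.ne).limsup_eq, add_zero]
  refine (ae_eq_of_ae_le_of_lintegral_le hle ?_ (hm.comp hT.measurable).aemeasurable ?_).symm
  · exact ne_top_of_le_ne_top hI (lintegral_liminf_div_le hT hs hsub)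
  · exact (hT.lintegral_comp hm).le

theorem ae_limsup_div_le_liminf_div_add [IsProbabilityMeasure μ] (hT : MeasurePreserving T μ μ)
    (hs : ∀ n, Measurable (s n)) (hI : ∫⁻ x, s 1 x ∂μ ≠ ⊤)
    (hsub : ∀ m n, ∀ᵐ x ∂μ, s (m + n) x ≤ s m (T^[n] x) + s n x) {ε : ENNReal} (hε : ε ≠ 0) :
    ∀ᵐ x ∂μ, limsup (fun n : ℕ => s n x / n) atTop
      ≤ liminf (fun n : ℕ => s n x / n) atTop + ε + ε := by
  set l : X → ENNReal := fun x => liminf (fun n : ℕ => s n x / n) atTop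
  have hl : Measurable l := Measurable.liminf fun n => (hs n).div_const _
  let B : ℕ → Set X := fun K => {x | ∀ m : ℕ, 1 ≤ m → m ≤ K → m * (l x + ε) < s m x}
  have hBm : ∀ K, MeasurableSet (B K) := by
    intro K
    have : B K = ⋂ m ∈ Finset.Icc 1 K, {x | m * (l x + ε) < s m x} := by
      ext x
      simp [B]
    rw [this]
    exact Finset.measurableSet_biInter _ fun m _ =>
      measurableSet_lt ((hl.add_const ε).const_mul _) (hs m)
  have hBanti : Antitone B := fun K K' hK x hx m h1 h2 => hx m h1 (h2.trans hK)
  have hBinter : μ (⋂ K, B K) = 0 := by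
    rw [measure_eq_zero_iff_ae_notMem]
    filter_upwards [ae_lt_top hl (ne_top_of_le_ne_top hI (lintegral_liminf_div_le hT hs hsub))]
      with x hx hmem
    have hfreq := frequently_lt_of_liminf_lt (h := ENNReal.lt_add_right hx.ne hε)
    obtain ⟨n, hn, hn1⟩ := (hfreq.and_eventually (eventually_ge_atTop 1)).exists
    have hn0 : (n : ENNReal) ≠ 0 := by exact_mod_cast (by omega : n ≠ 0)
    have h2 := Set.mem_iInter.1 hmem n n hn1 le_rfl
    rw [ENNReal.div_lt_iff (Or.inl hn0) (Or.inl (ENNReal.natCast_ne_top n)), mul_comm] at hn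
    exact lt_asymm h2 hn
  have hμB : Tendsto (fun K => μ (B K)) atTop (nhds 0) := by
    rw [← hBinter]
    exact tendsto_measure_iInter_atTop (fun K => (hBm K).nullMeasurableSet) hBanti
      ⟨0, measure_ne_top _ _⟩
  have hint : Tendsto (fun K => ∫⁻ x in B K, s 1 x ∂μ) atTop (nhds 0) :=
    tendsto_setLIntegral_zero hI hμB
  have hbound : ∀ K, 1 ≤ K →
      ε * μ {x | ¬ limsup (fun n : ℕ => s n x / n) atTop ≤ l x + ε + ε} ≤
        ∫⁻ x in B K, s 1 x ∂μ := by
    intro K hK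
    rw [← lintegral_indicator (hBm K)]
    refine le_trans ?_ (mul_measure_maximal_le hT ((hs 1).indicator (hBm K)) ε)
    gcongr 1
    refine measure_mono_ae ?_
    filter_upwards [ae_tendsto_birkhoffTail_div hT (hs 1) hI K,
      ae_forall_iterate hT (ae_all_iff.2 fun m => ae_all_iff.2 fun n => hsub m n),
      ae_forall_iterate hT (ae_liminf_div_comp_eq hT hs hI hsub)] with x htail hx1 hx2 hlim
    by_contra hmax
    refine hlim ?_
    have hmax' : ∀ n : ℕ, 1 ≤ n → birkhoffSum T ((B K).indicator (s 1)) n x ≤ n * ε := by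
      intro n hn
      by_contra hlt
      exact hmax ⟨n, hn, (not_le.1 hlt).le⟩
    have hle : ∀ n : ℕ, 1 ≤ n →
        s n x / n ≤ l x + ε + ε + birkhoffTail T (s 1) K n x / n := by
      intro n hn
      have hn0 : (n : ENNReal) ≠ 0 := by exact_mod_cast (by omega : n ≠ 0)
      have := le_add_birkhoffSum_indicator_add_birkhoffTail (T := T) (s := s)
        (r := fun x => l x + ε) (B := B K) (K := K)
        (D := {x | (∀ k m n, s (m + n) (T^[k] x) ≤ s m (T^[n] (T^[k] x)) + s n (T^[k] x)) ∧
          ∀ k, l (T (T^[k] x)) = l (T^[k] x)}) hK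
        (fun y hy => ⟨fun k => hy.1 (k + 1), fun k => hy.2 (k + 1)⟩)
        (fun y hy => hy.1 0) (fun y hy => congrArg (· + ε) (hy.2 0))
        (fun y _ hyB => by
          by_contra hcon
          push Not at hcon
          exact hyB hcon) hn ⟨hx1, hx2⟩
      refine ENNReal.div_le_of_le_mul ?_
      rw [add_mul _ _ (n : ENNReal), ENNReal.div_mul_cancel hn0 (ENNReal.natCast_ne_top n),
        add_mul _ _ (n : ENNReal), mul_comm _ (n : ENNReal), mul_comm ε]
      exact this.trans (by gcongr; exact hmax' n hn)
    have hlim' := (tendsto_const_nhds (x := l x + ε + ε)).add htail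
    rw [add_zero] at hlim'
    rw [← hlim'.limsup_eq]
    exact limsup_le_limsup ((eventually_ge_atTop 1).mono hle)
  have h0 := ge_of_tendsto hint ((eventually_ge_atTop 1).mono hbound)
  rw [ae_iff]
  exact (mul_eq_zero.1 (le_antisymm h0 zero_le)).resolve_left hε

/-- Kingman's subadditive ergodic theorem, for nonnegative cocycles. -/
theorem ae_limsup_div_le_liminf_div [IsProbabilityMeasure μ] (hT : MeasurePreserving T μ μ)
    (hs : ∀ n, Measurable (s n)) (hI : ∫⁻ x, s 1 x ∂μ ≠ ⊤)
    (hsub : ∀ m n, ∀ᵐ x ∂μ, s (m + n) x ≤ s m (T^[n] x) + s n x) :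
    ∀ᵐ x ∂μ, limsup (fun n : ℕ => s n x / n) atTop ≤ liminf (fun n : ℕ => s n x / n) atTop := by
  filter_upwards [ae_all_iff.2 fun j : ℕ => ae_limsup_div_le_liminf_div_add hT hs hI hsub
    (ε := (j : ENNReal)⁻¹) (by simp)] with x hx
  have h := (tendsto_const_nhds (x := liminf (fun n : ℕ => s n x / n) atTop)).add
    ENNReal.tendsto_inv_nat_nhds_zero |>.add ENNReal.tendsto_inv_nat_nhds_zero
  simp only [add_zero] at h
  exact ge_of_tendsto' h hx

end Subadditive

section NilpotentAction

open scoped commutatorElement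

variable {G : Type*} [Group G] {X : Type*} {T : G → X → X}

theorem action_iterate (hT1 : ∀ x, T 1 x = x) (hTmul : ∀ g h x, T (g * h) x = T g (T h x))
    (g : G) (n : ℕ) : (T g)^[n] = T (g ^ n) := by
  induction n with
  | zero => ext x; simp [hT1]
  | succ n ih => ext x; rw [Function.iterate_succ_apply, ih, pow_succ, hTmul]

variable [MeasurableSpace X] {μ : Measure X} {F : G → X → ENNReal}

theorem lintegral_mul_le (hTpres : ∀ g, MeasurePreserving (T g) μ μ)
    (hF : ∀ g, Measurable (F g))
    (hsub : ∀ g h : G, ∀ᵐ x ∂μ, F (g * h) x ≤ F g (T h x) + F h x) (g h : G) :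
    ∫⁻ x, F (g * h) x ∂μ ≤ ∫⁻ x, F g x ∂μ + ∫⁻ x, F h x ∂μ := by
  refine (lintegral_mono_ae (hsub g h)).trans_eq ?_
  rw [lintegral_add_right _ (hF h), (hTpres h).lintegral_comp (hF g)]

/-- Mean growth along commutators with powers of `g` is sublinear along powers of two. -/
theorem tendsto_lintegral_commutatorElement_div [Group.IsNilpotent G]
    (hTpres : ∀ g, MeasurePreserving (T g) μ μ) (hF : ∀ g, Measurable (F g))
    (hI : ∀ g, ∫⁻ x, F g x ∂μ ≠ ⊤)
    (hsub : ∀ g h : G, ∀ᵐ x ∂μ, F (g * h) x ≤ F g (T h x) + F h x) (g h : G) :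
    Tendsto (fun k : ℕ => (∫⁻ x, F ⁅g ^ 2 ^ k, h⁆ x ∂μ) / (2 ^ k : ℕ)) atTop (nhds 0) := by
  let L : G → ℝ := fun w => (∫⁻ x, F w x ∂μ).toReal + (∫⁻ x, F w⁻¹ x ∂μ).toReal
  have hmul : ∀ p q, (∫⁻ x, F (p * q) x ∂μ).toReal ≤
      (∫⁻ x, F p x ∂μ).toReal + (∫⁻ x, F q x ∂μ).toReal := by
    intro p q
    rw [← ENNReal.toReal_add (hI p) (hI q)]
    exact ENNReal.toReal_mono (ENNReal.add_ne_top.2 ⟨hI p, hI q⟩)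
      (lintegral_mul_le hTpres hF hsub p q)
  have hL := tendsto_length_commutatorElement_div (L := L) (fun p => by positivity)
    (fun p q => by
      have h1 := hmul p q
      have h2 := hmul q⁻¹ p⁻¹
      simp only [L, mul_inv_rev]
      linarith)
    (fun p => by simp only [L, inv_inv, add_comm]) g h
  have hL' := ENNReal.tendsto_ofReal hL
  rw [ENNReal.ofReal_zero] at hL'
  refine tendsto_of_tendsto_of_tendsto_of_le_of_le tendsto_const_nhds hL' (fun _ => zero_le)
    fun k => ?_
  rw [ENNReal.ofReal_div_of_pos (by positivity), ENNReal.ofReal_pow (by norm_num)]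
  simp only [Nat.cast_pow, Nat.cast_ofNat, ENNReal.ofReal_ofNat]
  gcongr
  rw [← ENNReal.ofReal_toReal (hI ⁅g ^ 2 ^ k, h⁆)]
  exact ENNReal.ofReal_le_ofReal (le_add_of_nonneg_right ENNReal.toReal_nonneg)

theorem ae_le_add_commutatorElement (hT1 : ∀ x, T 1 x = x)
    (hTmul : ∀ g h x, T (g * h) x = T g (T h x)) (hTpres : ∀ g, MeasurePreserving (T g) μ μ)
    (hsub : ∀ g h : G, ∀ᵐ x ∂μ, F (g * h) x ≤ F g (T h x) + F h x) (g h : G) :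
    ∀ᵐ x ∂μ, F g (T h x) ≤
      F g x + (F ⁅g, h⁆ (T (h * g) x) + F h (T g x) + F h⁻¹ (T h x)) := by
  filter_upwards [(hTpres h).quasiMeasurePreserving.ae (hsub ⁅g, h⁆ (h * g * h⁻¹)),
    (hTpres h).quasiMeasurePreserving.ae (hsub (h * g) h⁻¹), hsub h g] with x h1 h2 h3
  have hg : ⁅g, h⁆ * (h * g * h⁻¹) = g := by rw [commutatorElement_def]; group
  have hx : T h⁻¹ (T h x) = x := by rw [← hTmul, inv_mul_cancel, hT1]
  rw [hg, hTmul (h * g) h⁻¹, hx] at h1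
  rw [hx] at h2
  calc F g (T h x) ≤ F ⁅g, h⁆ (T (h * g) x) + (F h (T g x) + F g x + F h⁻¹ (T h x)) :=
        h1.trans (add_le_add_right (h2.trans (add_le_add_left h3 _)) _)
    _ = _ := by ring

theorem ae_tendsto_pow_div [IsProbabilityMeasure μ] (hT1 : ∀ x, T 1 x = x)
    (hTmul : ∀ g h x, T (g * h) x = T g (T h x)) (hTpres : ∀ g, MeasurePreserving (T g) μ μ)
    (hF : ∀ g, Measurable (F g)) (hI : ∀ g, ∫⁻ x, F g x ∂μ ≠ ⊤)
    (hsub : ∀ g h : G, ∀ᵐ x ∂μ, F (g * h) x ≤ F g (T h x) + F h x) (g : G) :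
    ∀ᵐ x ∂μ, Tendsto (fun n : ℕ => F (g ^ n) x / n) atTop
      (nhds (liminf (fun n : ℕ => F (g ^ n) x / n) atTop)) := by
  filter_upwards [ae_limsup_div_le_liminf_div (s := fun n => F (g ^ n)) (hTpres g)
    (fun n => hF _) (hI _) fun m n => by
      simpa only [action_iterate hT1 hTmul, pow_add] using hsub (g ^ m) (g ^ n)] with x hx
  exact tendsto_of_le_liminf_of_limsup_le le_rfl hx

theorem ae_liminf_pow_div_comp_le [Group.IsNilpotent G] [IsProbabilityMeasure μ]
    (hT1 : ∀ x, T 1 x = x)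
    (hTmul : ∀ g h x, T (g * h) x = T g (T h x)) (hTpres : ∀ g, MeasurePreserving (T g) μ μ)
    (hF : ∀ g, Measurable (F g)) (hI : ∀ g, ∫⁻ x, F g x ∂μ ≠ ⊤)
    (hsub : ∀ g h : G, ∀ᵐ x ∂μ, F (g * h) x ≤ F g (T h x) + F h x) (g h : G) :
    ∀ᵐ x ∂μ, liminf (fun n : ℕ => F (g ^ n) (T h x) / n) atTop ≤
      liminf (fun n : ℕ => F (g ^ n) x / n) atTop := by
  let e : ℕ → X → ENNReal := fun k x =>
    (F ⁅g ^ 2 ^ k, h⁆ (T (h * g ^ 2 ^ k) x) + F h (T (g ^ 2 ^ k) x) + F h⁻¹ (T h x)) / (2 ^ k : ℕ)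
  have hcomp : ∀ a b, Measurable fun x => F a (T b x) := fun a b =>
    (hF a).comp (hTpres b).measurable
  have hem : ∀ k, Measurable (e k) := fun k =>
    (((hcomp _ _).add (hcomp _ _)).add (hcomp _ _)).div_const _
  have hpow : Tendsto (fun k : ℕ => 2 ^ k) atTop atTop :=
    tendsto_pow_atTop_atTop_of_one_lt Nat.one_lt_two
  have hint : Tendsto (fun k => ∫⁻ x, e k x ∂μ) atTop (nhds 0) := by
    have hconst := (ENNReal.tendsto_const_div_natCast
      (ENNReal.add_ne_top.2 ⟨hI h, hI h⁻¹⟩)).comp hpow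
    have := (tendsto_lintegral_commutatorElement_div hTpres hF hI hsub g h).add hconst
    rw [add_zero] at this
    refine this.congr fun k => ?_
    simp only [e, div_eq_mul_inv, Function.comp_apply]
    rw [lintegral_mul_const' _ _ (by simp),
      lintegral_add_right _ (hcomp _ _), lintegral_add_right _ (hcomp _ _),
      (hTpres _).lintegral_comp (hF _), (hTpres _).lintegral_comp (hF _),
      (hTpres _).lintegral_comp (hF _), ← add_mul, add_assoc]
  have he0 : ∀ᵐ x ∂μ, liminf (fun k => e k x) atTop = 0 := by
    refine (lintegral_eq_zero_iff (Measurable.liminf hem)).1 (le_antisymm ?_ zero_le)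
    exact (lintegral_liminf_le hem).trans_eq hint.liminf_eq
  have hlim := ae_tendsto_pow_div hT1 hTmul hTpres hF hI hsub g
  filter_upwards [hlim, (hTpres h).quasiMeasurePreserving.ae hlim, he0,
    ae_all_iff.2 fun k : ℕ => ae_le_add_commutatorElement hT1 hTmul hTpres hsub (g ^ 2 ^ k) h]
    with x hx hTx hex hle
  rw [← (hTx.comp hpow).liminf_eq]
  calc _ ≤ liminf (fun k : ℕ => e k x + F (g ^ 2 ^ k) x / (2 ^ k : ℕ)) atTop := by
        refine liminf_le_liminf (Eventually.of_forall fun k => ?_)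
        rw [← ENNReal.add_div, add_comm]
        exact ENNReal.div_le_div_right (hle k) _
    _ ≤ _ := by
        refine (ENNReal.liminf_add_le_add _ _ _).trans_eq ?_
        rw [hex, zero_add]
        exact (hx.comp hpow).limsup_eq

end NilpotentAction

/-- Functions invariant under an ergodic action are almost surely constant. -/
theorem exists_ae_eq_const_of_ergodic {G X : Type*} [MeasurableSpace X] {μ : Measure X}
    [IsProbabilityMeasure μ] {T : G → X → X}
    (hErg : ∀ A : Set X, MeasurableSet A →
      (∀ g : G, μ (symmDiff (T g ⁻¹' A) A) = 0) → μ A = 0 ∨ μ A = 1)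
    {φ : X → ENNReal} (hφ : Measurable φ) (hinv : ∀ g, ∀ᵐ x ∂μ, φ (T g x) = φ x) :
    ∃ a, ∀ᵐ x ∂μ, φ x = a := by
  refine Filter.exists_eventuallyEq_const_of_forall_separating MeasurableSet fun U hU => ?_
  have hsymm : ∀ g, μ (symmDiff (T g ⁻¹' (φ ⁻¹' U)) (φ ⁻¹' U)) = 0 := by
    intro g
    rw [measure_symmDiff_eq_zero_iff]
    filter_upwards [hinv g] with x hx
    exact congrArg (· ∈ U) hx
  rcases hErg (φ ⁻¹' U) (hφ hU) hsymm with h | h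
  · exact Or.inr (measure_eq_zero_iff_ae_notMem.1 h)
  · exact Or.inl ((prob_compl_eq_zero_iff (hφ hU)).2 h)

theorem stmt3 {G : Type*} [Group G] [Group.IsNilpotent G] [Group.FG G]
    {X : Type*} [MeasurableSpace X] (μ : Measure X) [IsProbabilityMeasure μ]
    (T : G → X → X) (hTmeas : ∀ g, Measurable (T g))
    (hT1 : ∀ x, T 1 x = x) (hTmul : ∀ g h x, T (g * h) x = T g (T h x))
    (hTpres : ∀ g, MeasurePreserving (T g) μ μ)
    (hErg : ∀ A : Set X, MeasurableSet A →
      (∀ g : G, μ (symmDiff (T g ⁻¹' A) A) = 0) → μ A = 0 ∨ μ A = 1)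
    (f : G → X → ℝ) (hfmeas : ∀ g, Measurable (f g)) (hfpos : ∀ g x, 0 ≤ f g x)
    (hfsub : ∀ g h : G, ∀ᵐ x ∂μ, f (g * h) x ≤ f g (T h x) + f h x)
    (hfint : ∀ g, Integrable (f g) μ) :
    ∀ g : G, ∃ c : ℝ, c ≤ ∫ x, f g x ∂μ ∧
      ∀ᵐ x ∂μ, Tendsto (fun n : ℕ => f (g ^ n) x / n) atTop (nhds c) := by
  intro g
  let F : G → X → ENNReal := fun g x => ENNReal.ofReal (f g x)
  have hF : ∀ g, Measurable (F g) := fun g => (hfmeas g).ennreal_ofReal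
  have hFint : ∀ g, ∫⁻ x, F g x ∂μ = ENNReal.ofReal (∫ x, f g x ∂μ) := fun g =>
    (ofReal_integral_eq_lintegral_ofReal (hfint g) (Eventually.of_forall (hfpos g))).symm
  have hI : ∀ g, ∫⁻ x, F g x ∂μ ≠ ⊤ := fun g => by rw [hFint]; exact ENNReal.ofReal_ne_top
  have hsub : ∀ g h : G, ∀ᵐ x ∂μ, F (g * h) x ≤ F g (T h x) + F h x := by
    intro g h
    filter_upwards [hfsub g h] with x hx
    rw [← ENNReal.ofReal_add (hfpos _ _) (hfpos _ _)]
    exact ENNReal.ofReal_le_ofReal hx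
  let φ : X → ENNReal := fun x => liminf (fun n : ℕ => F (g ^ n) x / n) atTop
  have hφ : Measurable φ := Measurable.liminf fun n => (hF _).div_const _
  have hle : ∀ h, ∀ᵐ x ∂μ, φ (T h x) ≤ φ x :=
    ae_liminf_pow_div_comp_le hT1 hTmul hTpres hF hI hsub g
  have hinv : ∀ h, ∀ᵐ x ∂μ, φ (T h x) = φ x := by
    intro h
    filter_upwards [hle h, (hTpres h).quasiMeasurePreserving.ae (hle h⁻¹)] with x h1 h2
    rw [← hTmul, inv_mul_cancel, hT1] at h2
    exact le_antisymm h1 h2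
  obtain ⟨a, ha⟩ := exists_ae_eq_const_of_ergodic hErg hφ hinv
  have haI : a ≤ ENNReal.ofReal (∫ x, f g x ∂μ) := by
    have h1 := lintegral_liminf_div_le (s := fun n => F (g ^ n)) (hTpres g) (fun n => hF _)
      fun m n => by simpa only [action_iterate hT1 hTmul, pow_add] using hsub (g ^ m) (g ^ n)
    rw [pow_one, hFint, lintegral_congr_ae ha] at h1
    simpa using h1
  have hatop : a ≠ ⊤ := ne_top_of_le_ne_top ENNReal.ofReal_ne_top haI
  refine ⟨a.toReal, ENNReal.toReal_le_of_le_ofReal (integral_nonneg (hfpos g)) haI, ?_⟩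
  filter_upwards [ha, ae_tendsto_pow_div hT1 hTmul hTpres hF hI hsub g] with x hx hlim
  rw [show liminf (fun n : ℕ => F (g ^ n) x / n) atTop = a from hx] at hlim
  refine ((ENNReal.tendsto_toReal hatop).comp hlim).congr fun n => ?_
  simp [F, ENNReal.toReal_ofReal (hfpos _ _)]
end
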